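/- arXiv:2210.10755 — 3 statements merged into one kernel-verified Lean document; each statement's English description precedes it below -/
import Mathlib

section
/- There exists a constant c > 0 such that every P5-free graph G on n ≥ 1 vertices contains a homogeneous set of size at least 2^{c (log n)^{2/3}}, i.e., hom(G) ≥ 2^{c (log n)^{2/3}}. -/
open SimpleGraph

/-- A set of vertices is homogeneous if it induces a clique or an independent set. -/
def IsHomogeneous {V : Type*} (G : SimpleGraph V) (s : Finset V) : Prop :=
  G.IsClique (s : Set V) ∨ Gᶜ.IsClique (s : Set V)

/-- `hom(G)`: the largest size of a homogeneous set in `G`. -/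
noncomputable def homNum {V : Type*} (G : SimpleGraph V) : ℕ :=
  sSup {k : ℕ | ∃ s : Finset V, IsHomogeneous G s ∧ s.card = k}

/-- `G` contains no induced copy of `H`. -/
def IndFree {W V : Type*} (H : SimpleGraph W) (G : SimpleGraph V) : Prop :=
  ¬ Nonempty (H ↪g G)

/-- `G` has no induced path on five vertices. -/
def P5Free {V : Type*} (G : SimpleGraph V) : Prop :=
  IndFree (pathGraph 5) G


namespace P5EH

open Finset Classical

variable {V : Type*}

/-- pure pair -/
def PurePair (G : SimpleGraph V) (A B : Finset V) : Prop :=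
  (∀ a ∈ A, ∀ b ∈ B, G.Adj a b) ∨ (∀ a ∈ A, ∀ b ∈ B, ¬ G.Adj a b)

/-- cograph vertex sets -/
inductive Cog (G : SimpleGraph V) : Finset V → Prop
  | empty : Cog G ∅
  | single (v : V) : Cog G {v}
  | join (A B : Finset V) : Cog G A → Cog G B → Disjoint A B → PurePair G A B → Cog G (A ∪ B)

/-- largest cograph -/
noncomputable def cg (G : SimpleGraph V) (S : Finset V) : ℕ :=
  (S.powerset.filter (Cog G)).sup Finset.card

theorem le_cg {G : SimpleGraph V} {S C : Finset V} (hC : C ⊆ S) (h : Cog G C) :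
    C.card ≤ cg G S := by
  unfold cg
  exact Finset.le_sup (f := Finset.card) (by simp [hC, h])

theorem exists_cg (G : SimpleGraph V) (S : Finset V) :
    ∃ C ⊆ S, Cog G C ∧ C.card = cg G S := by
  have hne : (S.powerset.filter (Cog G)).Nonempty := ⟨∅, by simp [Cog.empty]⟩
  obtain ⟨C, hC, h⟩ := Finset.exists_mem_eq_sup _ hne Finset.card
  simp only [mem_filter, mem_powerset] at hC
  exact ⟨C, hC.1, hC.2, h.symm⟩

theorem cg_mono {G : SimpleGraph V} {S T : Finset V} (h : S ⊆ T) : cg G S ≤ cg G T := by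
  obtain ⟨C, hC, h1, h2⟩ := exists_cg G S
  rw [← h2]; exact le_cg (hC.trans h) h1

theorem PurePair.mono {G : SimpleGraph V} {A B A' B' : Finset V} (h : PurePair G A B)
    (hA : A' ⊆ A) (hB : B' ⊆ B) : PurePair G A' B' := by
  rcases h with h | h
  · exact Or.inl fun a ha b hb => h a (hA ha) b (hB hb)
  · exact Or.inr fun a ha b hb => h a (hA ha) b (hB hb)

theorem cg_add {G : SimpleGraph V} {A B S : Finset V} (hA : A ⊆ S) (hB : B ⊆ S)
    (hd : Disjoint A B) (hp : PurePair G A B) : cg G A + cg G B ≤ cg G S := by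
  obtain ⟨C, hC, h1, h2⟩ := exists_cg G A
  obtain ⟨D, hD, h3, h4⟩ := exists_cg G B
  have hd' : Disjoint C D := Finset.disjoint_of_subset_left hC (Finset.disjoint_of_subset_right hD hd)
  rw [← h2, ← h4, ← Finset.card_union_of_disjoint hd']
  exact le_cg (union_subset (hC.trans hA) (hD.trans hB)) (Cog.join _ _ h1 h3 hd' (hp.mono hC hD))

theorem cg_pos {G : SimpleGraph V} {S : Finset V} (h : S.Nonempty) : 1 ≤ cg G S := by
  obtain ⟨v, hv⟩ := h
  simpa using le_cg (C := {v}) (by simpa using hv) (Cog.single (G := G) v)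

theorem cog_clique {G : SimpleGraph V} (C : Finset V)
    (h : ∀ a ∈ C, ∀ b ∈ C, a ≠ b → G.Adj a b) : Cog G C := by
  induction C using Finset.induction_on with
  | empty => exact Cog.empty
  | insert a s ha ih =>
    rw [Finset.insert_eq]
    refine Cog.join _ _ (Cog.single a) (ih ?_) (by simpa using ha) (Or.inl ?_)
    · intro x hx y hy hxy
      exact h x (by simp [hx]) y (by simp [hy]) hxy
    · intro x hx y hy
      simp only [mem_singleton] at hx
      subst hx
      exact h x (by simp) y (by simp [hy]) (by rintro rfl; exact ha hy)

theorem cog_stable {G : SimpleGraph V} (C : Finset V)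
    (h : ∀ a ∈ C, ∀ b ∈ C, ¬ G.Adj a b) : Cog G C := by
  induction C using Finset.induction_on with
  | empty => exact Cog.empty
  | insert a s ha ih =>
    rw [Finset.insert_eq]
    refine Cog.join _ _ (Cog.single a) (ih ?_) (by simpa using ha) (Or.inr ?_)
    · intro x hx y hy
      exact h x (by simp [hx]) y (by simp [hy])
    · intro x hx y hy
      simp only [mem_singleton] at hx
      subst hx
      exact h x (by simp) y (by simp [hy])

theorem cog_hom {G : SimpleGraph V} {C : Finset V} (h : Cog G C) :
    ∃ K I : Finset V, K ⊆ C ∧ I ⊆ C ∧ G.IsClique (K : Set V) ∧ Gᶜ.IsClique (I : Set V) ∧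
      C.card ≤ K.card * I.card := by
  induction h with
  | empty => exact ⟨∅, ∅, by simp⟩
  | single v => exact ⟨{v}, {v}, by simp⟩
  | join A B hA hB hd hp ihA ihB =>
    obtain ⟨K, I, hK, hI, cK, cI, hc⟩ := ihA
    obtain ⟨K', I', hK', hI', cK', cI', hc'⟩ := ihB
    rw [Finset.card_union_of_disjoint hd]
    have dK : Disjoint K K' := Finset.disjoint_of_subset_left hK (Finset.disjoint_of_subset_right hK' hd)
    have dI : Disjoint I I' := Finset.disjoint_of_subset_left hI (Finset.disjoint_of_subset_right hI' hd)
    rcases hp with hp | hp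
    · have key : ∀ J : Finset V, J ⊆ A ∪ B → Gᶜ.IsClique (J : Set V) → I.card ≤ J.card →
          I'.card ≤ J.card → ∃ K I : Finset V, K ⊆ A ∪ B ∧ I ⊆ A ∪ B ∧ G.IsClique (K : Set V) ∧
          Gᶜ.IsClique (I : Set V) ∧ A.card + B.card ≤ K.card * I.card := by
        intro J hJ cJ h1 h2
        refine ⟨K ∪ K', J, union_subset_union hK hK', hJ, ?_, cJ, ?_⟩
        · intro x hx y hy hxy
          simp only [coe_union, Set.mem_union, mem_coe] at hx hy
          rcases hx with hx | hx <;> rcases hy with hy | hy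
          · exact cK hx hy hxy
          · exact hp x (hK hx) y (hK' hy)
          · exact (hp y (hK hy) x (hK' hx)).symm
          · exact cK' hx hy hxy
        · rw [Finset.card_union_of_disjoint dK]
          nlinarith [Nat.mul_le_mul_left K.card h1, Nat.mul_le_mul_left K'.card h2]
      rcases le_total I.card I'.card with h | h
      · exact key I' (hI'.trans subset_union_right) cI' h le_rfl
      · exact key I (hI.trans subset_union_left) cI le_rfl h
    · have key : ∀ J : Finset V, J ⊆ A ∪ B → G.IsClique (J : Set V) → K.card ≤ J.card →
          K'.card ≤ J.card → ∃ K I : Finset V, K ⊆ A ∪ B ∧ I ⊆ A ∪ B ∧ G.IsClique (K : Set V) ∧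
          Gᶜ.IsClique (I : Set V) ∧ A.card + B.card ≤ K.card * I.card := by
        intro J hJ cJ h1 h2
        refine ⟨J, I ∪ I', hJ, union_subset_union hI hI', cJ, ?_, ?_⟩
        · intro x hx y hy hxy
          simp only [coe_union, Set.mem_union, mem_coe] at hx hy
          rcases hx with hx | hx <;> rcases hy with hy | hy
          · exact cI hx hy hxy
          · rw [SimpleGraph.compl_adj]; exact ⟨hxy, hp x (hI hx) y (hI' hy)⟩
          · rw [SimpleGraph.compl_adj]
            exact ⟨hxy, fun h => hp y (hI hy) x (hI' hx) h.symm⟩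
          · exact cI' hx hy hxy
        · rw [Finset.card_union_of_disjoint dI]
          nlinarith [Nat.mul_le_mul_right I.card h1, Nat.mul_le_mul_right I'.card h2]
      rcases le_total K.card K'.card with h | h
      · exact key K' (hK'.trans subset_union_right) cK' h le_rfl
      · exact key K (hK.trans subset_union_left) cK le_rfl h

theorem cog_subst {G : SimpleGraph V} (C : V → Finset V) {T : Finset V} (hT : Cog G T)
    (hC : ∀ i ∈ T, Cog G (C i))
    (hd : ∀ i ∈ T, ∀ j ∈ T, i ≠ j → Disjoint (C i) (C j))
    (hp : ∀ i ∈ T, ∀ j ∈ T, i ≠ j → ∀ a ∈ C i, ∀ b ∈ C j, (G.Adj a b ↔ G.Adj i j)) :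
    Cog G (T.biUnion C) := by
  induction hT with
  | empty => simpa using Cog.empty
  | single v => simpa using hC v (by simp)
  | join A B hA hB hdAB hpAB ihA ihB =>
    rw [Finset.union_biUnion]
    have ne : ∀ i ∈ A, ∀ j ∈ B, i ≠ j := fun i hi j hj => by
      rintro rfl; exact (Finset.disjoint_left.1 hdAB hi hj)
    have mA : ∀ i ∈ A, i ∈ A ∪ B := fun i hi => by simp [hi]
    have mB : ∀ i ∈ B, i ∈ A ∪ B := fun i hi => by simp [hi]
    refine Cog.join _ _ (ihA (fun i hi => hC i (mA i hi)) (fun i hi j hj => hd i (mA i hi) j (mA j hj))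
      (fun i hi j hj => hp i (mA i hi) j (mA j hj)))
      (ihB (fun i hi => hC i (mB i hi)) (fun i hi j hj => hd i (mB i hi) j (mB j hj))
      (fun i hi j hj => hp i (mB i hi) j (mB j hj))) ?_ ?_
    · rw [Finset.disjoint_biUnion_left]
      intro i hi
      rw [Finset.disjoint_biUnion_right]
      intro j hj
      exact hd i (mA i hi) j (mB j hj) (ne i hi j hj)
    · rcases hpAB with h | h
      · left
        intro a ha b hb
        obtain ⟨i, hi, ha⟩ := mem_biUnion.1 ha
        obtain ⟨j, hj, hb⟩ := mem_biUnion.1 hb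
        exact (hp i (mA i hi) j (mB j hj) (ne i hi j hj) a ha b hb).2 (h i hi j hj)
      · right
        intro a ha b hb
        obtain ⟨i, hi, ha⟩ := mem_biUnion.1 ha
        obtain ⟨j, hj, hb⟩ := mem_biUnion.1 hb
        rw [hp i (mA i hi) j (mB j hj) (ne i hi j hj) a ha b hb]
        exact h i hi j hj

/-- weights lemma -/
theorem sum_small {ι : Type*} (β : ℝ) (hβ0 : 0 < β) (hβ1 : β ≤ 1) (w : ι → ℝ) (I : Finset ι)
    (hw0 : ∀ i ∈ I, 0 ≤ w i) (hw : ∀ i ∈ I, w i ≤ β ^ 5)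
    (hJ : ∀ J ⊆ I, J.Nonempty → ∃ i ∈ J, w i * (J.card : ℝ) ^ 5 ≤ 1) :
    I.card = 0 ∨ ∑ i ∈ I, w i ≤ β ^ 2 * (2 - 1 / (I.card : ℝ)) := by
  induction' hk : I.card with k ih generalizing I
  · left; rfl
  · right
    have hne : I.Nonempty := by rw [← Finset.card_pos]; omega
    obtain ⟨i, hi, hwi⟩ := hJ I (Subset.refl _) hne
    have hcard : (I.erase i).card = k := by rw [Finset.card_erase_of_mem hi]; omega
    have h1 := ih (I.erase i) (fun j hj => hw0 j (Finset.mem_of_mem_erase hj))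
      (fun j hj => hw j (Finset.mem_of_mem_erase hj))
      (fun J hJ' => hJ J (hJ'.trans (Finset.erase_subset _ _))) hcard
    rw [← Finset.add_sum_erase _ _ hi]
    rw [hk] at hwi
    have hK : (1:ℝ) ≤ ((k+1 : ℕ) : ℝ) := by push_cast; linarith [Nat.cast_nonneg (α := ℝ) k]
    set K : ℝ := ((k+1 : ℕ) : ℝ) with hKdef
    have hb : w i ≤ β ^ 2 * (1 / K) ^ 2 := by
      have ha : w i ≤ (1 / K) ^ 5 := by
        rw [one_div_pow, le_div_iff₀ (by positivity)]; exact hwi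
      have hK1 : 1 / K ≤ 1 := by rw [div_le_one (by linarith)]; exact hK
      have hK0 : 0 < 1 / K := by positivity
      have h5 : β ^ 5 ≤ β ^ 4 := pow_le_pow_of_le_one hβ0.le hβ1 (by norm_num)
      have h6 : (1/K) ^ 5 ≤ (1/K) ^ 4 := pow_le_pow_of_le_one hK0.le hK1 (by norm_num)
      have h7 : w i * w i ≤ β ^ 4 * (1/K) ^ 4 :=
        mul_le_mul ((hw i hi).trans h5) (ha.trans h6) (hw0 i hi) (by positivity)
      apply le_of_sq_le_sq _ (by positivity)
      nlinarith
    rcases Nat.eq_zero_or_pos k with h0 | hpos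
    · have : I.erase i = ∅ := by rw [← Finset.card_eq_zero]; omega
      rw [this, Finset.sum_empty]
      have : K = 1 := by rw [hKdef, h0]; simp
      rw [this] at hb ⊢
      norm_num at hb ⊢
      linarith
    · rcases h1 with h1 | h1
      · omega
      · have hk1 : (1:ℝ) ≤ (k:ℝ) := by exact_mod_cast hpos
        have hKk : K = k + 1 := by rw [hKdef]; push_cast; ring
        have h8 : (1 / K) ^ 2 ≤ 1 / (k:ℝ) - 1 / K := by
          rw [hKk, div_sub_div _ _ (by positivity) (by positivity), one_div_pow,
            div_le_div_iff₀ (by positivity) (by positivity)]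
          nlinarith
        nlinarith [mul_le_mul_of_nonneg_left h8 (sq_nonneg β)]

/-- module -/
def IsMod (G : SimpleGraph V) (X M : Finset V) : Prop :=
  M ⊆ X ∧ ∀ x ∈ X, x ∉ M → (∀ a ∈ M, G.Adj x a) ∨ (∀ a ∈ M, ¬ G.Adj x a)

theorem IsMod.union {G : SimpleGraph V} {X M N : Finset V} (hM : IsMod G X M) (hN : IsMod G X N)
    (h : ∃ a, a ∈ M ∧ a ∈ N) : IsMod G X (M ∪ N) := by
  obtain ⟨z, hz1, hz2⟩ := h
  refine ⟨union_subset hM.1 hN.1, fun x hx hxn => ?_⟩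
  simp only [mem_union, not_or] at hxn
  rcases hM.2 x hx hxn.1 with h1 | h1 <;> rcases hN.2 x hx hxn.2 with h2 | h2
  · left; intro a ha; rcases mem_union.1 ha with h | h
    · exact h1 a h
    · exact h2 a h
  · exact absurd (h1 z hz1) (h2 z hz2)
  · exact absurd (h2 z hz2) (h1 z hz1)
  · right; intro a ha; rcases mem_union.1 ha with h | h
    · exact h1 a h
    · exact h2 a h

theorem IsMod.inter {G : SimpleGraph V} {X M N : Finset V} (hM : IsMod G X M) (hN : IsMod G X N) :
    IsMod G X (M ∩ N) := by
  refine ⟨inter_subset_left.trans hM.1, fun x hx hxn => ?_⟩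
  by_cases h : x ∈ M
  · have h' : x ∉ N := fun h' => hxn (mem_inter.2 ⟨h, h'⟩)
    rcases hN.2 x hx h' with h1 | h1
    · left; intro a ha; exact h1 a (mem_inter.1 ha).2
    · right; intro a ha; exact h1 a (mem_inter.1 ha).2
  · rcases hM.2 x hx h with h1 | h1
    · left; intro a ha; exact h1 a (mem_inter.1 ha).1
    · right; intro a ha; exact h1 a (mem_inter.1 ha).1

theorem IsMod.pure {G : SimpleGraph V} {X M N : Finset V} (hM : IsMod G X M) (hN : IsMod G X N)
    (hd : Disjoint M N) {p q a b : V} (hp : p ∈ M) (hq : q ∈ N) (ha : a ∈ M) (hb : b ∈ N) :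
    G.Adj a b ↔ G.Adj p q := by
  have haN : a ∉ N := Finset.disjoint_left.1 hd ha
  have hqM : q ∉ M := Finset.disjoint_right.1 hd hq
  have h1 : G.Adj a b ↔ G.Adj a q := by
    rcases hN.2 a (hM.1 ha) haN with h | h <;> simp [h b hb, h q hq]
  have h2 : G.Adj q a ↔ G.Adj q p := by
    rcases hM.2 q (hN.1 hq) hqM with h | h <;> simp [h a ha, h p hp]
  rw [h1, G.adj_comm a q, h2, G.adj_comm q p]

/-- component of a in A -/
noncomputable def comp (G : SimpleGraph V) (A : Finset V) (a : V) : Finset V :=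
  A.filter (fun b => Relation.ReflTransGen (fun x y => G.Adj x y ∧ x ∈ A ∧ y ∈ A) a b)

theorem comp_eq {G : SimpleGraph V} {A : Finset V} {a b : V} (hb : b ∈ comp G A a) :
    comp G A b = comp G A a := by
  have hs : Relation.ReflTransGen (fun x y => G.Adj x y ∧ x ∈ A ∧ y ∈ A) b a := by
    have h := (mem_filter.1 hb).2
    haveI : Std.Symm (fun x y => G.Adj x y ∧ x ∈ A ∧ y ∈ A) :=
      ⟨fun x y hxy => ⟨hxy.1.symm, hxy.2.2, hxy.2.1⟩⟩
    exact Relation.ReflTransGen.stdSymm.symm _ _ h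
  ext c
  simp only [comp, mem_filter]
  constructor
  · rintro ⟨h1, h2⟩; exact ⟨h1, (mem_filter.1 hb).2.trans h2⟩
  · rintro ⟨h1, h2⟩; exact ⟨h1, hs.trans h2⟩

theorem mem_comp {G : SimpleGraph V} {A : Finset V} {a : V} (ha : a ∈ A) : a ∈ comp G A a := by
  simp [comp, ha, Relation.ReflTransGen.refl]

theorem adj_comp {G : SimpleGraph V} {A : Finset V} {a b c : V} (hb : b ∈ comp G A a)
    (hc : c ∈ A) (h : G.Adj b c) : c ∈ comp G A a := by
  have hb' := mem_filter.1 hb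
  exact mem_filter.2 ⟨hc, hb'.2.tail ⟨h, hb'.1, hc⟩⟩

theorem comp_isMod {G : SimpleGraph V} {X A : Finset V} (hA : A ⊆ X)
    (hP : ∀ x ∈ X, x ∉ A → ∀ a ∈ A, ∀ b ∈ A, G.Adj a b → G.Adj x a → G.Adj x b)
    (a : V) (ha : a ∈ A) : IsMod G X (comp G A a) := by
  refine ⟨(filter_subset _ _).trans hA, fun x hx hxn => ?_⟩
  by_cases hxA : x ∈ A
  · right
    intro b hb hadj
    exact hxn (adj_comp hb hxA hadj.symm)
  · have key : ∀ b, b ∈ A → Relation.ReflTransGen (fun x y => G.Adj x y ∧ x ∈ A ∧ y ∈ A) a b →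
        (G.Adj x b ↔ G.Adj x a) := by
      intro b hb hr
      clear hb
      induction hr with
      | refl => rfl
      | tail h1 h2 ih =>
        rw [← ih]
        exact ⟨hP x hx hxA _ h2.2.2 _ h2.2.1 h2.1.symm, hP x hx hxA _ h2.2.1 _ h2.2.2 h2.1⟩
    by_cases h : G.Adj x a
    · left; intro b hb
      exact (key b (mem_filter.1 hb).1 (mem_filter.1 hb).2).2 h
    · right; intro b hb
      rw [key b (mem_filter.1 hb).1 (mem_filter.1 hb).2]; exact h

theorem modPattern {G : SimpleGraph V} {X : Finset V} {lam h : ℝ} (hX : X.Nonempty)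
    (hcrit : ∀ Z ⊆ X, Z.Nonempty → (cg G X : ℝ) * ((Z.card : ℝ) / X.card) ^ (2 * lam) ≤ cg G Z)
    (hlam : 0 < lam) (hh : 0 < h)
    (hsmall : ∀ Q ⊆ X, Q.Nonempty → (Q.card : ℝ) ≤ h ^ 6 → (Q.card : ℝ) ^ (10 * lam) ≤ cg G Q)
    (J : Finset (Finset V)) (hJ : J.Nonempty) (hmod : ∀ M ∈ J, IsMod G X M)
    (hne : ∀ M ∈ J, M.Nonempty)
    (hdis : ∀ M ∈ J, ∀ N ∈ J, M ≠ N → Disjoint M N)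
    (hbig : ∀ M ∈ J, (X.card : ℝ) ≤ M.card * h ^ 6) :
    ∃ M ∈ J, ((M.card : ℝ) / X.card) * (J.card : ℝ) ^ 5 ≤ 1 := by
  by_contra hcon
  push Not at hcon
  have hm : (0:ℝ) < X.card := by exact_mod_cast hX.card_pos
  have hJ0 : (0:ℝ) < J.card := by exact_mod_cast hJ.card_pos
  have hJh : (J.card : ℝ) ≤ h ^ 6 := by
    have h1 : (J.biUnion id).card = ∑ M ∈ J, M.card := by
      rw [Finset.card_biUnion]; · rfl
      intro M hM N hN hMN; exact hdis M hM N hN hMN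
    have h2 : (J.biUnion id).card ≤ X.card := by
      apply Finset.card_le_card
      intro x hx
      obtain ⟨M, hM, hx⟩ := mem_biUnion.1 hx
      exact (hmod M hM).1 hx
    have h3 : (∑ M ∈ J, (M.card : ℝ)) ≤ X.card := by
      rw [h1] at h2; exact_mod_cast h2
    have h4 : ∑ M ∈ J, (X.card : ℝ) ≤ ∑ M ∈ J, (M.card * h ^ 6 : ℝ) := Finset.sum_le_sum hbig
    rw [Finset.sum_const, ← Finset.sum_mul, nsmul_eq_mul] at h4
    have h5 : (J.card : ℝ) * X.card ≤ X.card * h ^ 6 :=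
      h4.trans (mul_le_mul_of_nonneg_right h3 (by positivity))
    nlinarith
  have : ∀ M, ∃ x, M ∈ J → x ∈ M := by
    intro M
    by_cases hM : M ∈ J
    · obtain ⟨x, hx⟩ := hne M hM; exact ⟨x, fun _ => hx⟩
    · obtain ⟨x, hx⟩ := hX; exact ⟨x, fun h => absurd h hM⟩
  choose r hr using this
  have hrinj : ∀ M ∈ J, ∀ N ∈ J, r M ∈ N → M = N := by
    intro M hM N hN hmem
    by_contra hMN
    exact Finset.disjoint_left.1 (hdis M hM N hN hMN) (hr M hM) hmem
  set Q := J.image r with hQ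
  have hQcard : Q.card = J.card := by
    apply Finset.card_image_of_injOn
    intro M hM N hN hMN
    exact hrinj M hM N hN (by rw [hMN]; exact hr N hN)
  have hQX : Q ⊆ X := by
    intro x hx
    obtain ⟨M, hM, rfl⟩ := mem_image.1 hx
    exact (hmod M hM).1 (hr M hM)
  have hQne : Q.Nonempty := hJ.image r
  have hcgQ := hsmall Q hQX hQne (by rw [hQcard]; exact hJh)
  rw [hQcard] at hcgQ
  obtain ⟨T, hTQ, hTcog, hTcard⟩ := exists_cg G Q
  have : ∀ q, ∃ M, q ∈ Q → M ∈ J ∧ r M = q := by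
    intro q
    by_cases hq : q ∈ Q
    · obtain ⟨M, hM, h⟩ := mem_image.1 hq; exact ⟨M, fun _ => ⟨hM, h⟩⟩
    · exact ⟨∅, fun h => absurd h hq⟩
  choose e he using this
  have heinj : ∀ p ∈ Q, ∀ q ∈ Q, p ≠ q → e p ≠ e q := by
    intro p hp q hq hpq heq
    apply hpq
    rw [← (he p hp).2, ← (he q hq).2, heq]
  choose C hC1 hC2 hC3 using fun q => exists_cg G (e q)
  have hmem : ∀ q ∈ Q, q ∈ e q := fun q hq => by
    have := hr (e q) (he q hq).1
    rwa [(he q hq).2] at this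
  have hdisj : ∀ p ∈ Q, ∀ q ∈ Q, p ≠ q → Disjoint (e p) (e q) := fun p hp q hq hpq =>
    hdis _ (he p hp).1 _ (he q hq).1 (heinj p hp q hq hpq)
  have hdisjC : ∀ p ∈ Q, ∀ q ∈ Q, p ≠ q → Disjoint (C p) (C q) := fun p hp q hq hpq =>
    Finset.disjoint_of_subset_left (hC1 p) (Finset.disjoint_of_subset_right (hC1 q)
      (hdisj p hp q hq hpq))
  have hcog : Cog G (T.biUnion C) := by
    refine cog_subst C hTcog (fun i _ => hC2 i)
      (fun i hi j hj hij => hdisjC i (hTQ hi) j (hTQ hj) hij) ?_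
    intro i hi j hj hij a ha b hb
    exact (hmod _ (he i (hTQ hi)).1).pure (hmod _ (he j (hTQ hj)).1)
      (hdisj i (hTQ hi) j (hTQ hj) hij) (hmem i (hTQ hi)) (hmem j (hTQ hj)) (hC1 i ha) (hC1 j hb)
  have hle : (T.biUnion C).card ≤ cg G X := by
    refine le_cg ?_ hcog
    intro x hx
    obtain ⟨q, hq, hx⟩ := mem_biUnion.1 hx
    exact (hmod _ (he q (hTQ hq)).1).1 (hC1 q hx)
  rw [Finset.card_biUnion (fun i hi j hj hij => hdisjC i (hTQ hi) j (hTQ hj) hij)] at hle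
  have hcgX : (1:ℝ) ≤ cg G X := by exact_mod_cast cg_pos hX
  have hTpos : (0:ℝ) < T.card := by
    have := cg_pos (G := G) hQne
    rw [← hTcard] at this
    exact_mod_cast this
  have hTne : T.Nonempty := by rw [← Finset.card_pos]; exact_mod_cast hTpos
  have hlow : ∀ q ∈ T, (cg G X : ℝ) * ((J.card : ℝ) ^ (10 * lam))⁻¹ < (C q).card := by
    intro q hq
    have hq' := (he q (hTQ hq)).1
    have h1 := hcrit (e q) (hmod _ hq').1 (hne _ hq')
    rw [hC3 q]
    refine lt_of_lt_of_le ?_ h1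
    apply mul_lt_mul_of_pos_left _ (by linarith)
    have h2 := hcon _ hq'
    have h3 : ((J.card : ℝ) ^ 5)⁻¹ < ((e q).card : ℝ) / X.card := by
      rw [inv_lt_iff_one_lt_mul₀ (by positivity)]; linarith
    have h4 := Real.rpow_lt_rpow (by positivity) h3 (show 0 < 2 * lam by linarith)
    refine lt_of_eq_of_lt ?_ h4
    rw [Real.inv_rpow (by positivity), ← Real.rpow_natCast, ← Real.rpow_mul hJ0.le]
    congr 2; push_cast; ring
  have hsum : (∑ q ∈ T, (cg G X : ℝ) * ((J.card : ℝ) ^ (10 * lam))⁻¹) < ∑ q ∈ T, ((C q).card : ℝ) :=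
    Finset.sum_lt_sum_of_nonempty hTne hlow
  rw [Finset.sum_const, nsmul_eq_mul] at hsum
  have hle' : (∑ q ∈ T, ((C q).card : ℝ)) ≤ cg G X := by exact_mod_cast hle
  have hpos : (0:ℝ) < (J.card : ℝ) ^ (10 * lam) := by positivity
  rw [← hTcard] at hcgQ
  have : (cg G X : ℝ) ≤ T.card * ((cg G X : ℝ) * ((J.card : ℝ) ^ (10 * lam))⁻¹) := by
    rw [← div_eq_mul_inv, ← mul_div_assoc, le_div_iff₀ hpos, mul_comm]
    exact mul_le_mul_of_nonneg_right hcgQ (by linarith)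
  linarith

set_option maxHeartbeats 4000000 in
theorem modY {G : SimpleGraph V} {X : Finset V} {lam β h : ℝ} (hX : X.Nonempty)
    (hcrit : ∀ Z ⊆ X, Z.Nonempty → (cg G X : ℝ) * ((Z.card : ℝ) / X.card) ^ (2 * lam) ≤ cg G Z)
    (hlam : 0 < lam) (hh : 0 < h) (hβ0 : 0 < β) (hβ : β ≤ 1 / 100)
    (hη : ∀ x : ℝ, β ^ 5 < x → 1 / 2 < x ^ (2 * lam))
    (hsmall : ∀ Q ⊆ X, Q.Nonempty → (Q.card : ℝ) ≤ h ^ 6 → (Q.card : ℝ) ^ (10 * lam) ≤ cg G Q)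
    (hcg : (cg G X : ℝ) < h) :
    ∃ Y ⊆ X, (X.card : ℝ) / 4 ≤ Y.card ∧ ∀ A ⊆ X,
      (∀ x ∈ X, x ∉ A → ∀ a ∈ A, ∀ b ∈ A, G.Adj a b → G.Adj x a → G.Adj x b) →
      (Y ⊆ A ∨ ((A ∩ Y).card : ℝ) * h ^ 5 ≤ X.card) := by
  have hm : (0:ℝ) < X.card := by exact_mod_cast hX.card_pos
  have hcgX : (1:ℝ) ≤ cg G X := by exact_mod_cast cg_pos hX
  have hβ5 : β ^ 5 ≤ 1 / 100 := by
    calc β ^ 5 ≤ β ^ 1 := pow_le_pow_of_le_one hβ0.le (by linarith) (by norm_num)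
      _ ≤ 1 / 100 := by simpa using hβ
  have hβ5' : 0 < β ^ 5 := by positivity
  set m : ℝ := (X.card : ℝ) with hmdef
  -- pure pairs
  have hpure : ∀ A ⊆ X, ∀ B ⊆ X, Disjoint A B → PurePair G A B → β ^ 5 * m < A.card →
      (B.card : ℝ) ≤ β ^ 5 * m := by
    intro A hA B hB hd hp h1
    by_contra h2
    push Not at h2
    have key : ∀ Z ⊆ X, β ^ 5 * m < Z.card → (cg G X : ℝ) / 2 < cg G Z := by
      intro Z hZ h3
      have hZ0 : Z.Nonempty := by
        rw [← Finset.card_pos]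
        have : (0:ℝ) < Z.card := lt_trans (by positivity) h3
        exact_mod_cast this
      have h4 := hcrit Z hZ hZ0
      have h5 := hη ((Z.card : ℝ) / m) (by rw [lt_div_iff₀ hm]; exact h3)
      nlinarith
    have h3 := key A hA h1
    have h4 := key B hB h2
    have h5 : ((cg G A + cg G B : ℕ) : ℝ) ≤ cg G X := by exact_mod_cast cg_add hA hB hd hp
    push_cast at h5
    linarith
  have hdich : ∀ M, IsMod G X M → β ^ 5 * m < M.card → (m - 2 * β ^ 5 * m : ℝ) ≤ M.card := by
    intro M hM hMc
    set A := (X \ M).filter (fun x => ∀ a ∈ M, G.Adj x a)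
    set B := (X \ M).filter (fun x => ¬ ∀ a ∈ M, G.Adj x a)
    have h1 : A.card + B.card = (X \ M).card := Finset.card_filter_add_card_filter_not _
    have h2 : (X \ M).card + M.card = X.card := Finset.card_sdiff_add_card_eq_card hM.1
    have dA : Disjoint M A := by
      rw [Finset.disjoint_left]; intro x hx hxA
      exact (mem_sdiff.1 (mem_filter.1 hxA).1).2 hx
    have dB : Disjoint M B := by
      rw [Finset.disjoint_left]; intro x hx hxA
      exact (mem_sdiff.1 (mem_filter.1 hxA).1).2 hx
    have h3 := hpure M hM.1 A ((filter_subset _ _).trans sdiff_subset) dA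
      (Or.inl fun a ha b hb => ((mem_filter.1 hb).2 a ha).symm) hMc
    have h4 := hpure M hM.1 B ((filter_subset _ _).trans sdiff_subset) dB
      (Or.inr fun a ha b hb hadj => by
        have hb' := mem_filter.1 hb
        have hb'' := mem_sdiff.1 hb'.1
        rcases hM.2 b hb''.1 hb''.2 with h | h
        · exact hb'.2 h
        · exact h a ha hadj.symm) hMc
    have h5 : (A.card : ℝ) + B.card + M.card = m := by
      rw [hmdef]; rw [← h1] at h2; exact_mod_cast h2
    linarith
  -- smallest big module
  set 𝓑 := X.powerset.filter (fun M => IsMod G X M ∧ β ^ 5 * m < M.card) with h𝓑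
  have hXB : X ∈ 𝓑 := by
    simp only [h𝓑, mem_filter, mem_powerset, Subset.refl, true_and]
    refine ⟨⟨Subset.refl _, fun x hx hxn => absurd hx hxn⟩, ?_⟩
    nlinarith
  obtain ⟨X0, hX0, hX0min⟩ := Finset.exists_min_image 𝓑 Finset.card ⟨X, hXB⟩
  simp only [h𝓑, mem_filter, mem_powerset] at hX0
  obtain ⟨hX0X, hX0mod, hX0big⟩ := hX0
  have hX0card := hdich X0 hX0mod hX0big
  have hX0sub : ∀ M, IsMod G X M → β ^ 5 * m < M.card → X0 ⊆ M := by
    intro M hM hMb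
    have h1 := hdich M hM hMb
    have h2 : (M ∪ X0).card + (M ∩ X0).card = M.card + X0.card := Finset.card_union_add_card_inter _ _
    have h3 : (M ∪ X0).card ≤ X.card := Finset.card_le_card (union_subset hM.1 hX0X)
    have h2' : ((M ∪ X0).card : ℝ) + (M ∩ X0).card = M.card + X0.card := by exact_mod_cast h2
    have h3' : ((M ∪ X0).card : ℝ) ≤ m := by rw [hmdef]; exact_mod_cast h3
    have h4 : β ^ 5 * m < (M ∩ X0).card := by nlinarith
    have h5 := hX0min (M ∩ X0) (by
      simp only [h𝓑, mem_filter, mem_powerset]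
      exact ⟨inter_subset_left.trans hM.1, hM.inter hX0mod, h4⟩)
    have h6 : M ∩ X0 = X0 := Finset.eq_of_subset_of_card_le inter_subset_right h5
    rw [← h6]; exact inter_subset_left
  -- maximal small modules
  set 𝓢 := X.powerset.filter (fun M => IsMod G X M ∧ (M.card : ℝ) ≤ β ^ 5 * m) with h𝓢
  have memS : ∀ M, M ∈ 𝓢 ↔ IsMod G X M ∧ (M.card : ℝ) ≤ β ^ 5 * m := by
    intro M
    simp only [h𝓢, mem_filter, mem_powerset]
    exact ⟨fun h => h.2, fun h => ⟨h.1.1, h⟩⟩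
  set 𝓜 := 𝓢.filter (fun M => M.Nonempty ∧ m ≤ M.card * h ^ 6 ∧ ∀ M' ∈ 𝓢, M ⊆ M' → M' = M) with h𝓜
  have h𝓜S : ∀ M ∈ 𝓜, M ∈ 𝓢 := fun M hM => (mem_filter.1 hM).1
  have hSun : ∀ M ∈ 𝓢, ∀ N ∈ 𝓢, (∃ a, a ∈ M ∧ a ∈ N) → M ∪ N ∈ 𝓢 := by
    intro M hM N hN ha
    rw [memS] at hM hN ⊢
    have hu := hM.1.union hN.1 ha
    refine ⟨hu, ?_⟩
    by_contra hc
    push Not at hc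
    have h1 := hdich _ hu hc
    have h2 : ((M ∪ N).card : ℝ) ≤ M.card + N.card := by exact_mod_cast Finset.card_union_le M N
    nlinarith
  have hdis : ∀ M ∈ 𝓜, ∀ N ∈ 𝓜, M ≠ N → Disjoint M N := by
    intro M hM N hN hMN
    rw [Finset.disjoint_left]
    intro a haM haN
    have hu := hSun M (h𝓜S M hM) N (h𝓜S N hN) ⟨a, haM, haN⟩
    have h1 := (mem_filter.1 hM).2.2.2 _ hu subset_union_left
    have h2 := (mem_filter.1 hN).2.2.2 _ hu subset_union_right
    exact hMN (h1.symm.trans h2)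
  have hsum := sum_small β hβ0 (by linarith) (fun M : Finset V => (M.card : ℝ) / m) 𝓜
    (fun M _ => by positivity)
    (fun M hM => by rw [div_le_iff₀ hm]; exact ((memS M).1 (h𝓜S M hM)).2)
    (fun J hJ hJne => modPattern hX hcrit hlam hh hsmall J hJne
      (fun M hM => ((memS M).1 (h𝓜S M (hJ hM))).1)
      (fun M hM => (mem_filter.1 (hJ hM)).2.1)
      (fun M hM N hN => hdis M (hJ hM) N (hJ hN))
      (fun M hM => (mem_filter.1 (hJ hM)).2.2.1))
  have hU : ((𝓜.biUnion id).card : ℝ) ≤ m / 4 := by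
    have h1 : ((𝓜.biUnion id).card : ℝ) ≤ ∑ M ∈ 𝓜, (M.card : ℝ) := by
      exact_mod_cast Finset.card_biUnion_le
    rcases hsum with h0 | h0
    · rw [Finset.card_eq_zero] at h0
      rw [h0, Finset.biUnion_empty, Finset.card_empty, Nat.cast_zero]; linarith
    · rw [← Finset.sum_div, div_le_iff₀ hm] at h0
      have h2 : (0:ℝ) ≤ 1 / (𝓜.card : ℝ) := by positivity
      have h3 : β ^ 2 ≤ 1 / 100 := by nlinarith
      have h4 : β ^ 2 * (2 - 1 / (𝓜.card : ℝ)) ≤ 1 / 4 := by nlinarith [sq_nonneg β]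
      nlinarith
  refine ⟨X0 \ 𝓜.biUnion id, sdiff_subset.trans hX0X, ?_, ?_⟩
  · have h1 : X0.card ≤ (X0 \ 𝓜.biUnion id).card + (𝓜.biUnion id).card := by
      have := Finset.le_card_sdiff (𝓜.biUnion id) X0
      omega
    have h2 : (X0.card : ℝ) ≤ (X0 \ 𝓜.biUnion id).card + (𝓜.biUnion id).card := by exact_mod_cast h1
    nlinarith
  · intro A hA hAP
    set Y := X0 \ 𝓜.biUnion id with hY
    by_cases hbigc : ∃ a ∈ A, β ^ 5 * m < (comp G A a).card
    · left
      obtain ⟨a, ha, hc⟩ := hbigc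
      exact sdiff_subset.trans ((hX0sub _ (comp_isMod hA hAP a ha) hc).trans (filter_subset _ _))
    · right
      push Not at hbigc
      have hcs : ∀ a ∈ A ∩ Y, ((comp G A a).card : ℝ) * h ^ 6 ≤ m := by
        intro a ha
        have haA := (mem_inter.1 ha).1
        by_contra hc
        push Not at hc
        have hKS : comp G A a ∈ 𝓢 := (memS _).2 ⟨comp_isMod hA hAP a haA, hbigc a haA⟩
        obtain ⟨M, hKM, hMmax⟩ := Finset.exists_le_maximal 𝓢 hKS
        have haM : a ∈ M := hKM (mem_comp haA)
        have hMM : M ∈ 𝓜 := by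
          refine mem_filter.2 ⟨hMmax.1, ⟨a, haM⟩, ?_, ?_⟩
          · have : ((comp G A a).card : ℝ) ≤ M.card := by exact_mod_cast Finset.card_le_card hKM
            have h6 : 0 < h ^ 6 := by positivity
            nlinarith
          · intro M' hM' hsub
            exact Subset.antisymm (hMmax.2 hM' hsub) hsub
        have : a ∉ 𝓜.biUnion id := (mem_sdiff.1 (mem_inter.1 ha).2).2
        exact this (mem_biUnion.2 ⟨M, hMM, haM⟩)
      set 𝓚 := (A ∩ Y).image (comp G A) with h𝓚
      have hch : ∀ K, ∃ a, K ∈ 𝓚 → a ∈ A ∩ Y ∧ comp G A a = K := by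
        intro K
        by_cases hK : K ∈ 𝓚
        · obtain ⟨a, ha, h⟩ := mem_image.1 hK; exact ⟨a, fun _ => ⟨ha, h⟩⟩
        · obtain ⟨x, _⟩ := hX; exact ⟨x, fun h => absurd h hK⟩
      choose r hr using hch
      have hRcard : (𝓚.image r).card = 𝓚.card := by
        apply Finset.card_image_of_injOn
        intro K hK L hL hKL
        rw [← (hr K hK).2, ← (hr L hL).2, hKL]
      have hRcog : Cog G (𝓚.image r) := by
        apply cog_stable
        intro a ha b hb hadj
        obtain ⟨K, hK, rfl⟩ := mem_image.1 ha
        obtain ⟨L, hL, rfl⟩ := mem_image.1 hb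
        have h1 := (hr K hK)
        have h2 := (hr L hL)
        have h3 : r L ∈ comp G A (r K) :=
          adj_comp (mem_comp (mem_inter.1 h1.1).1) (mem_inter.1 h2.1).1 hadj
        have h4 := comp_eq h3
        rw [h2.2, h1.2] at h4
        rw [h4] at hadj
        exact G.loopless.irrefl _ hadj
      have hKcard : (𝓚.card : ℝ) < h := by
        refine lt_of_le_of_lt ?_ hcg
        rw [← hRcard]
        have : (𝓚.image r).card ≤ cg G X := by
          refine le_cg ?_ hRcog
          intro x hx
          obtain ⟨K, hK, rfl⟩ := mem_image.1 hx
          exact hA (mem_inter.1 (hr K hK).1).1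
        exact_mod_cast this
      have hcov : (A ∩ Y).card ≤ ∑ K ∈ 𝓚, K.card := by
        refine le_trans (Finset.card_le_card ?_) (Finset.card_biUnion_le (s := 𝓚) (t := id))
        intro a ha
        exact mem_biUnion.2 ⟨comp G A a, mem_image_of_mem _ ha, mem_comp (mem_inter.1 ha).1⟩
      have hcov' : ((A ∩ Y).card : ℝ) ≤ ∑ K ∈ 𝓚, (K.card : ℝ) := by exact_mod_cast hcov
      have h6 : 0 < h ^ 6 := by positivity
      have hK2 : ∑ K ∈ 𝓚, (K.card : ℝ) ≤ 𝓚.card * (m / h ^ 6) := by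
        rw [← nsmul_eq_mul]
        apply Finset.sum_le_card_nsmul
        intro K hK
        obtain ⟨a, ha, rfl⟩ := mem_image.1 hK
        rw [le_div_iff₀ h6]; exact hcs a ha
      have hfin : ((A ∩ Y).card : ℝ) ≤ h * (m / h ^ 6) :=
        (hcov'.trans hK2).trans (mul_le_mul_of_nonneg_right hKcard.le (by positivity))
      calc ((A ∩ Y).card : ℝ) * h ^ 5 ≤ h * (m / h ^ 6) * h ^ 5 :=
            mul_le_mul_of_nonneg_right hfin (by positivity)
        _ = m := by field_simp

/-- no induced five-vertex path -/
def NoP5 (G : SimpleGraph V) : Prop :=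
  ∀ a b c d e, G.Adj a b → G.Adj b c → G.Adj c d → G.Adj d e → ¬ G.Adj a c → ¬ G.Adj a d →
    ¬ G.Adj a e → ¬ G.Adj b d → ¬ G.Adj b e → ¬ G.Adj c e → False

theorem noP5_of {G : SimpleGraph V} (hG : P5Free G) : NoP5 G := by
  intro a b c d e hab hbc hcd hde hac had hae hbd hbe hce
  apply hG
  have h1 := hab.symm
  have h2 := hbc.symm
  have h3 := hcd.symm
  have h4 := hde.symm
  have s1 : ¬ G.Adj c a := fun h => hac h.symm
  have s2 : ¬ G.Adj d a := fun h => had h.symm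
  have s3 : ¬ G.Adj e a := fun h => hae h.symm
  have s4 : ¬ G.Adj d b := fun h => hbd h.symm
  have s5 : ¬ G.Adj e b := fun h => hbe h.symm
  have s6 : ¬ G.Adj e c := fun h => hce h.symm
  have n1 : a ≠ b := hab.ne
  have n2 : b ≠ c := hbc.ne
  have n3 : c ≠ d := hcd.ne
  have n4 : d ≠ e := hde.ne
  have n5 : a ≠ c := by rintro rfl; exact had hcd
  have n6 : a ≠ d := by rintro rfl; exact hae hde
  have n7 : a ≠ e := by rintro rfl; exact hbe h1
  have n8 : b ≠ d := by rintro rfl; exact hbe hde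
  have n9 : b ≠ e := by rintro rfl; exact hbd h4
  have n10 : c ≠ e := by rintro rfl; exact hbe hbc
  refine ⟨⟨⟨![a, b, c, d, e], ?_⟩, ?_⟩⟩
  · intro i j hij
    fin_cases i <;> fin_cases j <;> simp_all
  · intro i j
    change G.Adj (![a, b, c, d, e] i) (![a, b, c, d, e] j) ↔ _
    fin_cases i <;> fin_cases j <;> simp_all [SimpleGraph.pathGraph_adj]

/-- minimal counterexample package -/
structure Crit (G : SimpleGraph V) (Ω : Finset V) (lam β h : ℝ) : Prop where
  noP5 : NoP5 G
  lam_pos : 0 < lam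
  hβ0 : 0 < β
  hβ : β ≤ 1 / 10000
  hdef : (Ω.card : ℝ) ^ lam = h
  hh : 2 ≤ h
  h0 : (cg G Ω : ℝ) < h
  h1 : ∀ Z ⊆ Ω, Z ≠ Ω → Z.Nonempty → (Z.card : ℝ) ^ lam ≤ cg G Z
  h2 : ∀ Z ⊆ Ω, Z ≠ Ω → Z.Nonempty → (Z.card : ℝ) ≤ h ^ 6 → (Z.card : ℝ) ^ (10 * lam) ≤ cg G Z
  f1 : ∀ x : ℝ, β ^ 10 ≤ x → 1 / 2 ≤ x ^ lam
  f2 : ∀ x : ℝ, β ^ 5 < x → 1 / 2 < x ^ (2 * lam)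
  f3 : 1 ≤ β ^ 10 * Ω.card
  f4 : (h ^ lam) ^ 4 ≤ 1 / β
  f5 : 8 * h ≤ Ω.card

theorem Crit.npos {G : SimpleGraph V} {Ω : Finset V} {lam β h : ℝ} (K : Crit G Ω lam β h) :
    (0:ℝ) < Ω.card := by
  by_contra hc
  push Not at hc
  have h1 := K.f3
  have h2 := K.hβ0
  have : 0 < β ^ 10 := by positivity
  nlinarith

theorem Crit.big {G : SimpleGraph V} {Ω : Finset V} {lam β h : ℝ} (K : Crit G Ω lam β h)
    {Z : Finset V} (hZ : Z ⊆ Ω) (hne : Z ≠ Ω) (hc : β ^ 10 * Ω.card ≤ Z.card) :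
    h / 2 ≤ cg G Z := by
  have hn := K.npos
  have hZ0 : (0:ℝ) < Z.card := by linarith [K.f3]
  have h1 := K.h1 Z hZ hne (by rw [← Finset.card_pos]; exact_mod_cast hZ0)
  have h2 := K.f1 ((Z.card : ℝ) / Ω.card) (by rw [le_div_iff₀ hn]; exact hc)
  rw [Real.div_rpow hZ0.le hn.le, K.hdef, le_div_iff₀ (by linarith [K.hh])] at h2
  linarith

theorem Crit.pure {G : SimpleGraph V} {Ω : Finset V} {lam β h : ℝ} (K : Crit G Ω lam β h)
    {A B : Finset V} (hA : A ⊆ Ω) (hB : B ⊆ Ω) (hd : Disjoint A B) (hp : PurePair G A B)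
    (h1 : β ^ 10 * Ω.card ≤ A.card) (h2 : β ^ 10 * Ω.card ≤ B.card) : False := by
  have hA0 : A.Nonempty := by
    rw [← Finset.card_pos]
    have : (0:ℝ) < A.card := by linarith [K.f3]
    exact_mod_cast this
  have hB0 : B.Nonempty := by
    rw [← Finset.card_pos]
    have : (0:ℝ) < B.card := by linarith [K.f3]
    exact_mod_cast this
  have hAn : A ≠ Ω := by
    rintro rfl
    obtain ⟨b, hb⟩ := hB0
    exact Finset.disjoint_left.1 hd (hB hb) hb
  have hBn : B ≠ Ω := by
    rintro rfl
    obtain ⟨b, hb⟩ := hA0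
    exact Finset.disjoint_left.1 hd hb (hA hb)
  have h3 := K.big hA hAn h1
  have h4 := K.big hB hBn h2
  have h5 : ((cg G A + cg G B : ℕ) : ℝ) ≤ cg G Ω := by exact_mod_cast cg_add hA hB hd hp
  push_cast at h5
  linarith [K.h0]

theorem nearJoin {G : SimpleGraph V} {C Y : Finset V} {h : ℝ} (hh : 2 ≤ h) (hC : (C.card : ℝ) ≤ h)
    (hY : ∀ u ∈ C, ((Y.filter (fun y => ¬ G.Adj u y)).card : ℝ) * h ^ 5 ≤ 4 * Y.card) :
    ∃ Y' ⊆ Y, (Y.card : ℝ) / 2 ≤ Y'.card ∧ ∀ u ∈ C, ∀ y ∈ Y', G.Adj u y := by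
  refine ⟨Y.filter (fun y => ∀ u ∈ C, G.Adj u y), filter_subset _ _, ?_, ?_⟩
  · have h1 : (Y.filter (fun y => ∀ u ∈ C, G.Adj u y)).card +
        (Y.filter (fun y => ¬ ∀ u ∈ C, G.Adj u y)).card = Y.card :=
      Finset.card_filter_add_card_filter_not _
    have h2 : (Y.filter (fun y => ¬ ∀ u ∈ C, G.Adj u y)).card ≤
        ∑ u ∈ C, (Y.filter (fun y => ¬ G.Adj u y)).card := by
      refine le_trans (Finset.card_le_card ?_) Finset.card_biUnion_le
      intro y hy
      obtain ⟨hy1, hy2⟩ := mem_filter.1 hy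
      push Not at hy2
      obtain ⟨u, hu, hu2⟩ := hy2
      exact mem_biUnion.2 ⟨u, hu, mem_filter.2 ⟨hy1, hu2⟩⟩
    have h2' : ((Y.filter (fun y => ¬ ∀ u ∈ C, G.Adj u y)).card : ℝ) ≤
        ∑ u ∈ C, ((Y.filter (fun y => ¬ G.Adj u y)).card : ℝ) := by exact_mod_cast h2
    have h5 : 0 < h ^ 5 := by positivity
    have h3 : ∑ u ∈ C, ((Y.filter (fun y => ¬ G.Adj u y)).card : ℝ) ≤
        C.card * (4 * Y.card / h ^ 5) := by
      rw [← nsmul_eq_mul]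
      apply Finset.sum_le_card_nsmul
      intro u hu
      rw [le_div_iff₀ h5]; exact hY u hu
    have h4 : (C.card : ℝ) * (4 * Y.card / h ^ 5) ≤ h * (4 * Y.card / h ^ 5) :=
      mul_le_mul_of_nonneg_right hC (by positivity)
    have h6 : h * (4 * Y.card / h ^ 5) ≤ Y.card / 2 := by
      have e : h * (4 * Y.card / h ^ 5) = 4 * Y.card / h ^ 4 := by field_simp
      rw [e, div_le_div_iff₀ (by positivity) (by norm_num)]
      have : (2:ℝ) ^ 4 ≤ h ^ 4 := pow_le_pow_left₀ (by norm_num) hh 4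
      nlinarith [Nat.cast_nonneg (α := ℝ) Y.card]
    have h1' : ((Y.filter (fun y => ∀ u ∈ C, G.Adj u y)).card : ℝ) +
        (Y.filter (fun y => ¬ ∀ u ∈ C, G.Adj u y)).card = Y.card := by exact_mod_cast h1
    linarith
  · intro u hu y hy
    exact (mem_filter.1 hy).2 u hu

theorem Crit.module {G : SimpleGraph V} {Ω : Finset V} {lam β h : ℝ} (K : Crit G Ω lam β h)
    {v : V} {P : Finset V} (hP : P ⊆ Ω) (hne : P ≠ Ω) (hP0 : P.Nonempty)
    (hv : ∀ x ∈ P, ¬ G.Adj v x) :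
    ∃ Y ⊆ P, (P.card : ℝ) ^ 2 ≤ 4 * Ω.card * Y.card ∧ ∀ u, G.Adj v u →
      (∀ y ∈ Y, ¬ G.Adj u y) ∨
      ((Y.filter (fun y => ¬ G.Adj u y)).card : ℝ) * h ^ 5 ≤ 4 * Y.card := by
  have hn := K.npos
  have hlam := K.lam_pos
  obtain ⟨X, hX, hXmin⟩ := Finset.exists_min_image (P.powerset.filter (fun X => X.Nonempty))
    (fun X => (cg G X : ℝ) / (X.card : ℝ) ^ (2 * lam)) ⟨P, by simp [hP0]⟩
  simp only [mem_filter, mem_powerset] at hX hXmin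
  obtain ⟨hXP, hX0⟩ := hX
  have hXc : (0:ℝ) < X.card := by exact_mod_cast hX0.card_pos
  have hPc : (0:ℝ) < P.card := by exact_mod_cast hP0.card_pos
  have hPsub : ∀ Z ⊆ P, Z ≠ Ω := by
    rintro Z hZ rfl
    exact hne (Subset.antisymm hP hZ)
  have hcrit : ∀ Z ⊆ X, Z.Nonempty →
      (cg G X : ℝ) * ((Z.card : ℝ) / X.card) ^ (2 * lam) ≤ cg G Z := by
    intro Z hZ hZ0
    have hZc : (0:ℝ) < Z.card := by exact_mod_cast hZ0.card_pos
    have h1 := hXmin Z ⟨hZ.trans hXP, hZ0⟩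
    rw [le_div_iff₀ (by positivity)] at h1
    rw [Real.div_rpow hZc.le hXc.le, ← mul_div_assoc, mul_div_right_comm]
    exact h1
  have hsize : (P.card : ℝ) ^ 2 < Ω.card * X.card := by
    have h1 := hXmin P ⟨Subset.refl _, hP0⟩
    have h2 := K.h1 X (hXP.trans hP) (hPsub X hXP) hX0
    have h3 : (cg G P : ℝ) < (Ω.card : ℝ) ^ lam := by
      rw [K.hdef]
      refine lt_of_le_of_lt ?_ K.h0
      exact_mod_cast cg_mono hP
    rw [div_le_div_iff₀ (by positivity) (by positivity)] at h1
    have e : ∀ x : ℝ, 0 < x → x ^ (2 * lam) = x ^ lam * x ^ lam := by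
      intro x hx
      rw [← Real.rpow_add hx]; congr 1; ring
    rw [e _ hXc, e _ hPc] at h1
    have pX : 0 < (X.card : ℝ) ^ lam := by positivity
    have pP : 0 < (P.card : ℝ) ^ lam := by positivity
    have pO : 0 < (Ω.card : ℝ) ^ lam := by positivity
    have h4 : (P.card : ℝ) ^ lam * (P.card : ℝ) ^ lam < (Ω.card : ℝ) ^ lam * (X.card : ℝ) ^ lam := by
      have h5 : (X.card : ℝ) ^ lam * ((P.card : ℝ) ^ lam * (P.card : ℝ) ^ lam) <
          (X.card : ℝ) ^ lam * ((Ω.card : ℝ) ^ lam * (X.card : ℝ) ^ lam) := by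
        calc _ ≤ (cg G X : ℝ) * ((P.card : ℝ) ^ lam * (P.card : ℝ) ^ lam) :=
              mul_le_mul_of_nonneg_right h2 (by positivity)
          _ ≤ _ := h1
          _ < (Ω.card : ℝ) ^ lam * ((X.card : ℝ) ^ lam * (X.card : ℝ) ^ lam) :=
              mul_lt_mul_of_pos_right h3 (by positivity)
          _ = _ := by ring
      exact lt_of_mul_lt_mul_left h5 pX.le
    rw [← Real.mul_rpow hPc.le hPc.le, ← Real.mul_rpow hn.le hXc.le] at h4
    have := (Real.rpow_lt_rpow_iff (by positivity) (by positivity) hlam).1 h4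
    nlinarith
  have hcgX : (cg G X : ℝ) < h := by
    refine lt_of_le_of_lt ?_ K.h0
    exact_mod_cast cg_mono (hXP.trans hP)
  obtain ⟨Y, hYX, hYc, hY⟩ := modY hX0 hcrit hlam (by linarith [K.hh]) K.hβ0
    (by linarith [K.hβ]) K.f2
    (fun Q hQ hQ0 hQc => K.h2 Q (hQ.trans (hXP.trans hP)) (hPsub Q (hQ.trans hXP)) hQ0 hQc) hcgX
  refine ⟨Y, hYX.trans hXP, ?_, ?_⟩
  · nlinarith
  · intro u hu
    rcases hY (X.filter (fun x => ¬ G.Adj u x)) (filter_subset _ _) (by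
      intro x hx hxn a ha b hb hab hxa
      by_contra hxb
      have hux : G.Adj u x := by
        by_contra hc
        exact hxn (mem_filter.2 ⟨hx, hc⟩)
      obtain ⟨ha1, ha2⟩ := mem_filter.1 ha
      obtain ⟨hb1, hb2⟩ := mem_filter.1 hb
      exact K.noP5 v u x a b hu hux hxa hab (hv x (hXP hx)) (hv a (hXP ha1)) (hv b (hXP hb1))
        ha2 hb2 hxb) with h1 | h1
    · left
      intro y hy
      exact (mem_filter.1 (h1 hy)).2
    · right
      have e : X.filter (fun x => ¬ G.Adj u x) ∩ Y = Y.filter (fun y => ¬ G.Adj u y) := by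
        ext y
        simp only [mem_inter, mem_filter]
        constructor
        · rintro ⟨⟨_, h2⟩, h3⟩; exact ⟨h3, h2⟩
        · rintro ⟨h2, h3⟩; exact ⟨⟨hYX h2, h3⟩, h2⟩
      rw [e] at h1
      linarith

theorem cog_ext {G : SimpleGraph V} {C Y : Finset V} (hC : Cog G C)
    (h : ∀ u ∈ C, ∀ y ∈ Y, G.Adj u y) :
    ∃ D ⊆ C ∪ Y, Cog G D ∧ D.card = C.card + cg G Y := by
  obtain ⟨E, hE, hE1, hE2⟩ := exists_cg G Y
  have hd : Disjoint C E := by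
    rw [Finset.disjoint_left]
    intro x hx hx'
    exact G.loopless.irrefl _ (h x hx x (hE hx'))
  refine ⟨C ∪ E, union_subset_union_right hE,
    Cog.join _ _ hC hE1 hd (Or.inl fun a ha b hb => h a ha b (hE hb)), ?_⟩
  rw [Finset.card_union_of_disjoint hd, hE2]

theorem Crit.dich {G : SimpleGraph V} {Ω : Finset V} {lam β h : ℝ} (K : Crit G Ω lam β h)
    {v : V} (hv : v ∈ Ω) :
    ((Ω.filter (fun x => x ≠ v ∧ ¬ G.Adj v x)).card : ℝ) < β * Ω.card ∨
    ((Ω.filter (fun x => G.Adj v x)).card : ℝ) < β * Ω.card := by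
  by_contra hcon
  push Not at hcon
  obtain ⟨c1, c2⟩ := hcon
  have hn := K.npos
  have hβ0 := K.hβ0
  have hβ := K.hβ
  have hb8 : β ^ 8 ≤ 1 / 8 := by
    calc β ^ 8 ≤ β ^ 1 := pow_le_pow_of_le_one hβ0.le (by linarith) (by norm_num)
      _ ≤ 1 / 8 := by linarith
  have hb10 : β ^ 10 ≤ β ^ 2 / 8 := by
    have : β ^ 10 = β ^ 2 * β ^ 8 := by ring
    rw [this]; nlinarith [sq_nonneg β]
  have hb2 : β ^ 2 ≤ β := by nlinarith
  have hb10n : β ^ 10 * Ω.card ≤ β ^ 2 / 8 * Ω.card := mul_le_mul_of_nonneg_right hb10 hn.le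
  have hb2n : β ^ 2 * Ω.card ≤ β * Ω.card := mul_le_mul_of_nonneg_right hb2 hn.le
  have hb2p : 0 < β ^ 2 * Ω.card := by positivity
  set P := Ω.filter (fun x => x ≠ v ∧ ¬ G.Adj v x) with hP
  set N := Ω.filter (fun x => G.Adj v x) with hN
  have hPn : P ≠ Ω := by
    intro h
    rw [← h] at hv
    exact (mem_filter.1 hv).2.1 rfl
  have hPc : (0:ℝ) < P.card := lt_of_lt_of_le (by positivity) c1
  obtain ⟨Y, hYP, hYc, hY⟩ := K.module (v := v) (filter_subset _ _ : P ⊆ Ω) hPn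
    (by rw [← Finset.card_pos]; exact_mod_cast hPc) (fun x hx => (mem_filter.1 hx).2.2)
  have hYΩ : Y ⊆ Ω := hYP.trans (filter_subset _ _)
  have hYc' : β ^ 2 * Ω.card / 4 ≤ Y.card := by
    have h1 : (β * Ω.card) ^ 2 ≤ (P.card : ℝ) ^ 2 := pow_le_pow_left₀ (by positivity) c1 2
    have h2 : (β ^ 2 * Ω.card) * Ω.card ≤ (4 * Y.card) * Ω.card := by nlinarith
    have := le_of_mul_le_mul_right h2 hn
    linarith
  have hsplit : (N.filter (fun u => ∀ y ∈ Y, ¬ G.Adj u y)).card +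
      (N.filter (fun u => ¬ ∀ y ∈ Y, ¬ G.Adj u y)).card = N.card :=
    Finset.card_filter_add_card_filter_not _
  set U1 := N.filter (fun u => ∀ y ∈ Y, ¬ G.Adj u y) with hU1
  set U2 := N.filter (fun u => ¬ ∀ y ∈ Y, ¬ G.Adj u y) with hU2
  have hsplit' : (U1.card : ℝ) + U2.card = N.card := by exact_mod_cast hsplit
  have hU2Ω : U2 ⊆ Ω := (filter_subset _ _).trans (filter_subset _ _)
  rcases le_or_gt (β * Ω.card / 2) (U1.card : ℝ) with h1 | h1
  · refine K.pure ((filter_subset _ _).trans (filter_subset _ _) : U1 ⊆ Ω) hYΩ ?_ (Or.inr ?_)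
      (by linarith) (by linarith)
    · rw [Finset.disjoint_left]
      intro x hx hx'
      exact (mem_filter.1 (hYP hx')).2.2 (mem_filter.1 (mem_filter.1 hx).1).2
    · intro a ha b hb
      exact (mem_filter.1 ha).2 b hb
  · have h2 : β * Ω.card / 2 ≤ U2.card := by linarith
    obtain ⟨C, hC1, hC2, hC3⟩ := exists_cg G U2
    have hvU2 : U2 ≠ Ω := by
      intro h
      rw [← h] at hv
      exact G.loopless.irrefl _ (mem_filter.1 (mem_filter.1 hv).1).2
    have hb := K.big hU2Ω hvU2 (by linarith)
    rw [← hC3] at hb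
    have hCh : (C.card : ℝ) < h := by
      refine lt_of_le_of_lt ?_ K.h0
      exact_mod_cast le_cg (hC1.trans hU2Ω) hC2
    obtain ⟨Y', hY'Y, hY'c, hY'⟩ := nearJoin K.hh hCh.le (fun u hu => by
      have hu' := mem_filter.1 (hC1 hu)
      rcases hY u (mem_filter.1 hu'.1).2 with h3 | h3
      · exact absurd h3 hu'.2
      · exact h3)
    obtain ⟨D, hD, hD1, hD2⟩ := cog_ext hC2 hY'
    have hvY : Y' ≠ Ω := by
      intro h
      rw [← h] at hv
      exact (mem_filter.1 (hYP (hY'Y hv))).2.1 rfl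
    have hb' := K.big (hY'Y.trans hYΩ) hvY (by linarith)
    have hDle : (D.card : ℝ) ≤ cg G Ω := by
      exact_mod_cast le_cg (hD.trans (union_subset (hC1.trans hU2Ω) (hY'Y.trans hYΩ))) hD1
    have hD2' : (D.card : ℝ) = C.card + cg G Y' := by exact_mod_cast hD2
    linarith [K.h0]

/-- connectivity by splits -/
def Conn (G : SimpleGraph V) (C : Finset V) : Prop :=
  ∀ D ⊆ C, D.Nonempty → D ≠ C → ∃ x ∈ D, ∃ y ∈ C, y ∉ D ∧ G.Adj x y

theorem conn_exists {G : SimpleGraph V} {W : Finset V} (hW0 : W.Nonempty)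
    (hW : ∀ A ⊆ W, ∀ B ⊆ W, Disjoint A B → (∀ a ∈ A, ∀ b ∈ B, ¬ G.Adj a b) →
      (W.card : ℝ) / 4 ≤ A.card → (W.card : ℝ) / 4 ≤ B.card → False) :
    ∃ C ⊆ W, (W.card : ℝ) / 2 < C.card ∧ (∀ x ∈ C, ∀ y ∈ W, y ∉ C → ¬ G.Adj x y) ∧ Conn G C := by
  have hwp : (0:ℝ) < W.card := by exact_mod_cast hW0.card_pos
  obtain ⟨C, hC, hmin⟩ := Finset.exists_min_image (W.powerset.filter (fun C =>
    (W.card : ℝ) / 2 < C.card ∧ ∀ x ∈ C, ∀ y ∈ W, y ∉ C → ¬ G.Adj x y)) Finset.card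
    ⟨W, by
      simp only [mem_filter, mem_powerset, Subset.refl, true_and]
      exact ⟨by linarith, fun x _ y hy hyn => absurd hy hyn⟩⟩
  simp only [mem_filter, mem_powerset] at hC hmin
  obtain ⟨hCW, hCc, hCa⟩ := hC
  refine ⟨C, hCW, hCc, hCa, ?_⟩
  intro D hD hD0 hDC
  by_contra hno
  push Not at hno
  have key : ∀ E ⊆ C, E ≠ C → (∀ x ∈ E, ∀ y ∈ C, y ∉ E → ¬ G.Adj x y) →
      (E.card : ℝ) < W.card / 4 := by
    intro E hE hEC hEa
    have hEa' : ∀ x ∈ E, ∀ y ∈ W, y ∉ E → ¬ G.Adj x y := by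
      intro x hx y hy hyE
      by_cases hyC : y ∈ C
      · exact hEa x hx y hyC hyE
      · exact hCa x (hE hx) y hy hyC
    have hlt : E.card < C.card := Finset.card_lt_card (hE.ssubset_of_ne hEC)
    have h1 : (E.card : ℝ) ≤ W.card / 2 := by
      by_contra hc
      push Not at hc
      have := hmin E ⟨hE.trans hCW, hc, hEa'⟩
      omega
    by_contra hc
    push Not at hc
    have h2 : (W \ E).card + E.card = W.card := Finset.card_sdiff_add_card_eq_card (hE.trans hCW)
    have h2' : ((W \ E).card : ℝ) + E.card = W.card := by exact_mod_cast h2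
    exact hW E (hE.trans hCW) (W \ E) sdiff_subset Finset.disjoint_sdiff
      (fun a ha b hb => hEa' a ha b (mem_sdiff.1 hb).1 (mem_sdiff.1 hb).2) hc (by linarith)
  have h1 := key D hD hDC (fun x hx y hy hyD => hno x hx y hy hyD)
  have h2 := key (C \ D) sdiff_subset (by
    intro h
    obtain ⟨d, hd⟩ := hD0
    have := hD hd
    rw [← h] at this
    exact (mem_sdiff.1 this).2 hd) (by
    intro x hx y hy hyn hadj
    have hyD : y ∈ D := by
      by_contra hc
      exact hyn (mem_sdiff.2 ⟨hy, hc⟩)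
    exact hno y hyD x (mem_sdiff.1 hx).1 (mem_sdiff.1 hx).2 hadj.symm)
  have h3 : (C \ D).card + D.card = C.card := Finset.card_sdiff_add_card_eq_card hD
  have h3' : ((C \ D).card : ℝ) + D.card = C.card := by exact_mod_cast h3
  linarith

theorem Crit.conn {G : SimpleGraph V} {Ω : Finset V} {lam β h : ℝ} (K : Crit G Ω lam β h)
    {W : Finset V} (hW : W ⊆ Ω) (hc : (Ω.card : ℝ) / 128 ≤ W.card) :
    ∃ C ⊆ W, (W.card : ℝ) / 2 < C.card ∧ (∀ x ∈ C, ∀ y ∈ W, y ∉ C → ¬ G.Adj x y) ∧ Conn G C := by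
  have hn := K.npos
  have hβ0 := K.hβ0
  have hβ := K.hβ
  have hb10 : β ^ 10 ≤ 1 / 512 := by
    calc β ^ 10 ≤ β ^ 1 := pow_le_pow_of_le_one hβ0.le (by linarith) (by norm_num)
      _ ≤ 1 / 512 := by linarith
  have hb10n : β ^ 10 * Ω.card ≤ 1 / 512 * Ω.card := mul_le_mul_of_nonneg_right hb10 hn.le
  have hWp : (0:ℝ) < W.card := by linarith
  apply conn_exists (by rw [← Finset.card_pos]; exact_mod_cast hWp)
  intro A hA B hB hd hab h1 h2
  exact K.pure (hA.trans hW) (hB.trans hW) hd (Or.inr hab) (by linarith) (by linarith)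

theorem Crit.step {G : SimpleGraph V} {Ω : Finset V} {lam β h : ℝ} (K : Crit G Ω lam β h)
    {C : Finset V} (hC : C ⊆ Ω) (hc : (Ω.card : ℝ) / 64 ≤ C.card) (hconn : Conn G C) (v : V)
    (hdeg : ((Ω.filter (fun x => G.Adj v x)).card : ℝ) < β * Ω.card)
    (hv : v ∈ C ∨ ∃ x ∈ C, G.Adj v x) :
    ∃ C' ⊆ C, Conn G C' ∧ (C.card : ℝ) / 4 ≤ C'.card ∧ (∀ x ∈ C', ¬ G.Adj v x) ∧
      ∃ v' ∈ C, G.Adj v v' ∧ ∃ y ∈ C', G.Adj v' y := by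
  have hn := K.npos
  have hβ0 := K.hβ0
  have hβ := K.hβ
  have hb1 : 1 ≤ β * Ω.card := by
    have : β ^ 10 ≤ β ^ 1 := pow_le_pow_of_le_one hβ0.le (by linarith) (by norm_num)
    have := mul_le_mul_of_nonneg_right this hn.le
    rw [pow_one] at this
    linarith [K.f3]
  have hbn : β * Ω.card ≤ 1 / 10000 * Ω.card := mul_le_mul_of_nonneg_right hβ hn.le
  set W := C.filter (fun x => x ≠ v ∧ ¬ G.Adj v x) with hW
  have hWC : W ⊆ C := filter_subset _ _
  have hcard : C.card ≤ W.card + ((Ω.filter (fun x => G.Adj v x)).card + 1) := by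
    have : C ⊆ W ∪ (Ω.filter (fun x => G.Adj v x) ∪ {v}) := by
      intro x hx
      simp only [hW, mem_union, mem_filter, mem_singleton]
      by_cases h1 : x = v
      · right; right; exact h1
      · by_cases h2 : G.Adj v x
        · right; left; exact ⟨hC hx, h2⟩
        · left; exact ⟨hx, h1, h2⟩
    refine (Finset.card_le_card this).trans ((Finset.card_union_le _ _).trans ?_)
    have := Finset.card_union_le (Ω.filter (fun x => G.Adj v x)) {v}
    rw [Finset.card_singleton] at this
    omega
  have hcard' : (C.card : ℝ) ≤ W.card + ((Ω.filter (fun x => G.Adj v x)).card + 1) := by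
    exact_mod_cast hcard
  have hWc : (C.card : ℝ) / 2 ≤ W.card := by linarith
  obtain ⟨C', hC'W, hC'c, hC'a, hC'⟩ := K.conn (hWC.trans hC) (by linarith)
  refine ⟨C', hC'W.trans hWC, hC', by linarith, fun x hx => (mem_filter.1 (hC'W hx)).2.2, ?_⟩
  have hne : C' ≠ C := by
    intro h
    rw [← h] at hv
    rcases hv with hv | ⟨x, hx, hvx⟩
    · exact (mem_filter.1 (hC'W hv)).2.1 rfl
    · exact (mem_filter.1 (hC'W hx)).2.2 hvx
  have hC'0 : C'.Nonempty := by
    rw [← Finset.card_pos]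
    have : (0:ℝ) < C'.card := by linarith
    exact_mod_cast this
  obtain ⟨x, hx, y, hy, hyn, hadj⟩ := hconn C' (hC'W.trans hWC) hC'0 hne
  have hyW : y ∉ W := fun h => hC'a x hx y h hyn hadj
  have hxW := (mem_filter.1 (hC'W hx)).2
  refine ⟨y, hy, ?_, x, hx, hadj.symm⟩
  by_contra hc
  apply hyW
  refine mem_filter.2 ⟨hy, ?_, hc⟩
  rintro rfl
  exact hxW.2 hadj.symm

theorem Crit.caseA {G : SimpleGraph V} {Ω : Finset V} {lam β h : ℝ} (K : Crit G Ω lam β h)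
    {S : Finset V} (hS : S ⊆ Ω) (hSc : (Ω.card : ℝ) / 2 ≤ S.card)
    (hdeg : ∀ v ∈ S, ((Ω.filter (fun x => G.Adj v x)).card : ℝ) < β * Ω.card) : False := by
  have hn := K.npos
  obtain ⟨C0, hC0S, hC0c, -, hC0⟩ := K.conn hS (by linarith)
  have hC00 : C0.Nonempty := by
    rw [← Finset.card_pos]
    have : (0:ℝ) < C0.card := by linarith
    exact_mod_cast this
  obtain ⟨v1, hv1⟩ := hC00
  obtain ⟨C1, hC1, hC1conn, hC1c, hC1a, v2, hv2, h12, y, hy, h2y⟩ :=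
    K.step (hC0S.trans hS) (by linarith) hC0 v1 (hdeg v1 (hC0S hv1)) (Or.inl hv1)
  have hC1S := hC1.trans hC0S
  obtain ⟨C2, hC2, hC2conn, hC2c, hC2a, v3, hv3, h23, z, hz, h3z⟩ :=
    K.step (hC1S.trans hS) (by linarith) hC1conn v2 (hdeg v2 (hC0S hv2)) (Or.inr ⟨y, hy, h2y⟩)
  have hC2S := hC2.trans hC1S
  obtain ⟨C3, hC3, hC3conn, hC3c, hC3a, v4, hv4, h34, v5, hv5, h45⟩ :=
    K.step (hC2S.trans hS) (by linarith) hC2conn v3 (hdeg v3 (hC1S hv3)) (Or.inr ⟨z, hz, h3z⟩)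
  exact K.noP5 v1 v2 v3 v4 v5 h12 h23 h34 h45 (hC1a _ hv3) (hC1a _ (hC2 hv4))
    (hC1a _ (hC2 (hC3 hv5))) (hC2a _ hv4) (hC2a _ (hC3 hv5)) (hC3a _ hv5)

theorem greedy {G : SimpleGraph V} {d : ℝ} (k : ℕ) : ∀ S : Finset V, S.card ≤ k →
    (∀ v ∈ S, ((S.filter (fun x => x ≠ v ∧ ¬ G.Adj v x)).card : ℝ) + 1 ≤ d) →
    ∃ K ⊆ S, (∀ a ∈ K, ∀ b ∈ K, a ≠ b → G.Adj a b) ∧ (S.card : ℝ) ≤ d * K.card := by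
  induction k with
  | zero =>
    intro S hS _
    have : S = ∅ := by rw [← Finset.card_eq_zero]; omega
    subst this
    exact ⟨∅, Subset.refl _, by simp, by simp⟩
  | succ k ih =>
    intro S hS hd
    rcases S.eq_empty_or_nonempty with h0 | ⟨v, hv⟩
    · subst h0
      exact ⟨∅, Subset.refl _, by simp, by simp⟩
    · set T := S.filter (fun x => G.Adj v x) with hT
      have hTS : T ⊆ S := filter_subset _ _
      have hvT : v ∉ T := fun h => G.loopless.irrefl _ (mem_filter.1 h).2
      have hlt : T.card < S.card :=
        Finset.card_lt_card (hTS.ssubset_of_ne (fun h => hvT (h ▸ hv)))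
      obtain ⟨K, hK, hKc, hKd⟩ := ih T (by omega) (by
        intro x hx
        refine le_trans ?_ (hd x (hTS hx))
        have : (T.filter (fun y => y ≠ x ∧ ¬ G.Adj x y)).card ≤
          (S.filter (fun y => y ≠ x ∧ ¬ G.Adj x y)).card :=
          Finset.card_le_card (Finset.filter_subset_filter _ hTS)
        have : ((T.filter (fun y => y ≠ x ∧ ¬ G.Adj x y)).card : ℝ) ≤
          (S.filter (fun y => y ≠ x ∧ ¬ G.Adj x y)).card := by exact_mod_cast this
        linarith)
      have hvK : v ∉ K := fun h => hvT (hK h)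
      refine ⟨insert v K, ?_, ?_, ?_⟩
      · intro x hx
        rcases mem_insert.1 hx with rfl | hx
        · exact hv
        · exact hTS (hK hx)
      · intro a ha b hb hab
        rcases mem_insert.1 ha with h1 | h1 <;> rcases mem_insert.1 hb with h2 | h2
        · exact absurd (h1.trans h2.symm) hab
        · rw [h1]; exact (mem_filter.1 (hK h2)).2
        · rw [h2]; exact (mem_filter.1 (hK h1)).2.symm
        · exact hKc a h1 b h2 hab
      · rw [Finset.card_insert_of_notMem hvK]
        have hcard : S.card ≤ T.card + ((S.filter (fun x => x ≠ v ∧ ¬ G.Adj v x)).card + 1) := by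
          have : S ⊆ T ∪ (S.filter (fun x => x ≠ v ∧ ¬ G.Adj v x) ∪ {v}) := by
            intro x hx
            simp only [hT, mem_union, mem_filter, mem_singleton]
            by_cases h1 : x = v
            · right; right; exact h1
            · by_cases h2 : G.Adj v x
              · left; exact ⟨hx, h2⟩
              · right; left; exact ⟨hx, h1, h2⟩
          refine (Finset.card_le_card this).trans ((Finset.card_union_le _ _).trans ?_)
          have := Finset.card_union_le (S.filter (fun x => x ≠ v ∧ ¬ G.Adj v x)) {v}
          rw [Finset.card_singleton] at this
          omega
        have hcard' : (S.card : ℝ) ≤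
            T.card + ((S.filter (fun x => x ≠ v ∧ ¬ G.Adj v x)).card + 1) := by exact_mod_cast hcard
        have := hd v hv
        push_cast
        linarith

theorem Crit.caseB_ind {G : SimpleGraph V} {Ω : Finset V} {lam β h : ℝ} (K : Crit G Ω lam β h)
    {S : Finset V} (hS : S ⊆ Ω)
    (hdeg : ∀ v ∈ S, ((Ω.filter (fun x => x ≠ v ∧ ¬ G.Adj v x)).card : ℝ) < β * Ω.card) (i : ℕ) :
    ∀ S' ⊆ S, (Ω.card : ℝ) / 4 + 4 * i * (β * Ω.card) ≤ S'.card →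
    ∃ C ⊆ S', Cog G C ∧ (i : ℝ) * ((Ω.card : ℝ) / (512 * h ^ 2)) ^ lam ≤ C.card := by
  have hn := K.npos
  have hβ0 := K.hβ0
  have hβ := K.hβ
  have hh := K.hh
  have hh0 : 0 < h := by linarith
  have hb1 : 1 ≤ β * Ω.card := by
    have : β ^ 10 ≤ β ^ 1 := pow_le_pow_of_le_one hβ0.le (by linarith) (by norm_num)
    have := mul_le_mul_of_nonneg_right this hn.le
    rw [pow_one] at this
    linarith [K.f3]
  induction i with
  | zero =>
    intro S' _ _
    exact ⟨∅, empty_subset _, Cog.empty, by simp⟩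
  | succ i ih =>
    intro S' hS' hc
    push_cast at hc
    have hip : 0 ≤ (i : ℝ) * (β * Ω.card) := by positivity
    have hex : ∃ v ∈ S', (Ω.card : ℝ) / (4 * h) <
        ((S'.filter (fun x => x ≠ v ∧ ¬ G.Adj v x)).card : ℝ) + 1 := by
      by_contra hno
      push Not at hno
      obtain ⟨Q, hQ, hQc, hQd⟩ := greedy S'.card S' le_rfl hno
      have h1 : (Q.card : ℝ) ≤ cg G Ω := by
        exact_mod_cast le_cg (hQ.trans (hS'.trans hS)) (cog_clique Q hQc)
      have h2 : (Q.card : ℝ) < h := lt_of_le_of_lt h1 K.h0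
      have h3 : (Ω.card : ℝ) / (4 * h) * Q.card < (Ω.card : ℝ) / (4 * h) * h :=
        mul_lt_mul_of_pos_left h2 (by positivity)
      have h4 : (Ω.card : ℝ) / (4 * h) * h = Ω.card / 4 := by field_simp
      linarith
    obtain ⟨v, hv, hvc⟩ := hex
    set P := S'.filter (fun x => x ≠ v ∧ ¬ G.Adj v x) with hP
    have hPS : P ⊆ S' := filter_subset _ _
    have hPc : (Ω.card : ℝ) / (8 * h) ≤ P.card := by
      have h1 : 1 ≤ (Ω.card : ℝ) / (8 * h) := by
        rw [le_div_iff₀ (by positivity)]; linarith [K.f5]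
      have h2 : (Ω.card : ℝ) / (4 * h) = 2 * ((Ω.card : ℝ) / (8 * h)) := by field_simp; norm_num
      linarith
    have hPpos : (0:ℝ) < P.card := lt_of_lt_of_le (by positivity) hPc
    have hPn : P ≠ Ω := by
      intro h
      have : v ∈ P := by rw [h]; exact hS (hS' hv)
      exact (mem_filter.1 this).2.1 rfl
    obtain ⟨Y, hYP, hYc, hY⟩ := K.module (v := v) (hPS.trans (hS'.trans hS)) hPn
      (by rw [← Finset.card_pos]; exact_mod_cast hPpos) (fun x hx => (mem_filter.1 hx).2.2)
    have hYc' : (Ω.card : ℝ) / (256 * h ^ 2) ≤ Y.card := by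
      have h1 : ((Ω.card : ℝ) / (8 * h)) ^ 2 ≤ (P.card : ℝ) ^ 2 :=
        pow_le_pow_left₀ (by positivity) hPc 2
      have h2 : ((Ω.card : ℝ) / (8 * h)) ^ 2 = (4 * Ω.card) * ((Ω.card : ℝ) / (256 * h ^ 2)) := by
        field_simp; norm_num
      have h3 : (4 * (Ω.card : ℝ)) * ((Ω.card : ℝ) / (256 * h ^ 2)) ≤ (4 * Ω.card) * Y.card := by
        linarith
      exact le_of_mul_le_mul_left h3 (by positivity)
    have hYpos : (0:ℝ) < Y.card := lt_of_lt_of_le (by positivity) hYc'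
    have hY0 : Y.Nonempty := by rw [← Finset.card_pos]; exact_mod_cast hYpos
    obtain ⟨y0, hy0⟩ := hY0
    have hYS : Y ⊆ S' := hYP.trans hPS
    set S'' := S'.filter (fun x => G.Adj v x ∧ G.Adj y0 x) with hS''
    have hcard : S'.card ≤ S''.card + ((Ω.filter (fun x => x ≠ v ∧ ¬ G.Adj v x)).card + 1 +
        ((Ω.filter (fun x => x ≠ y0 ∧ ¬ G.Adj y0 x)).card + 1)) := by
      have hsub : S' ⊆ S'' ∪ (insert v (Ω.filter (fun x => x ≠ v ∧ ¬ G.Adj v x)) ∪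
          insert y0 (Ω.filter (fun x => x ≠ y0 ∧ ¬ G.Adj y0 x))) := by
        intro x hx
        have hxΩ := hS (hS' hx)
        simp only [hS'', mem_union, mem_filter, mem_insert]
        tauto
      refine (Finset.card_le_card hsub).trans ((Finset.card_union_le _ _).trans ?_)
      have h1 := Finset.card_union_le (insert v (Ω.filter (fun x => x ≠ v ∧ ¬ G.Adj v x)))
        (insert y0 (Ω.filter (fun x => x ≠ y0 ∧ ¬ G.Adj y0 x)))
      have h2 := Finset.card_insert_le v (Ω.filter (fun x => x ≠ v ∧ ¬ G.Adj v x))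
      have h3 := Finset.card_insert_le y0 (Ω.filter (fun x => x ≠ y0 ∧ ¬ G.Adj y0 x))
      omega
    have hcard' : (S'.card : ℝ) ≤ S''.card + ((Ω.filter (fun x => x ≠ v ∧ ¬ G.Adj v x)).card + 1 +
        ((Ω.filter (fun x => x ≠ y0 ∧ ¬ G.Adj y0 x)).card + 1)) := by exact_mod_cast hcard
    have d1 := hdeg v (hS' hv)
    have d2 := hdeg y0 (hS' (hYS hy0))
    obtain ⟨C, hC1, hC2, hC3⟩ := ih S'' ((filter_subset _ _).trans hS') (by linarith)
    have hCS : C ⊆ S' := hC1.trans (filter_subset _ _)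
    have hCh : (C.card : ℝ) < h := by
      refine lt_of_le_of_lt ?_ K.h0
      exact_mod_cast le_cg (hCS.trans (hS'.trans hS)) hC2
    obtain ⟨Y', hY'Y, hY'c, hY'⟩ := nearJoin K.hh hCh.le (fun u hu => by
      have hu' := (mem_filter.1 (hC1 hu)).2
      rcases hY u hu'.1 with h3 | h3
      · exact absurd hu'.2.symm (h3 y0 hy0)
      · exact h3)
    obtain ⟨D, hD, hD1, hD2⟩ := cog_ext hC2 hY'
    have hD2' : (D.card : ℝ) = C.card + cg G Y' := by exact_mod_cast hD2
    refine ⟨D, hD.trans (union_subset hCS (hY'Y.trans hYS)), hD1, ?_⟩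
    have hY'pos : (0:ℝ) < Y'.card := by linarith
    have hY'n : Y' ≠ Ω := by
      intro h
      have : v ∈ Y' := by rw [h]; exact hS (hS' hv)
      exact (mem_filter.1 (hYP (hY'Y this))).2.1 rfl
    have h1 := K.h1 Y' ((hY'Y.trans hYS).trans (hS'.trans hS)) hY'n
      (by rw [← Finset.card_pos]; exact_mod_cast hY'pos)
    have h2 : ((Ω.card : ℝ) / (512 * h ^ 2)) ^ lam ≤ (Y'.card : ℝ) ^ lam := by
      apply Real.rpow_le_rpow (by positivity) _ K.lam_pos.le
      have : (Ω.card : ℝ) / (512 * h ^ 2) = (Ω.card : ℝ) / (256 * h ^ 2) / 2 := by field_simp; norm_num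
      linarith
    push_cast
    linarith

theorem Crit.caseB {G : SimpleGraph V} {Ω : Finset V} {lam β h : ℝ} (K : Crit G Ω lam β h)
    {S : Finset V} (hS : S ⊆ Ω) (hSc : (Ω.card : ℝ) / 2 ≤ S.card)
    (hdeg : ∀ v ∈ S, ((Ω.filter (fun x => x ≠ v ∧ ¬ G.Adj v x)).card : ℝ) < β * Ω.card) :
    False := by
  have hn := K.npos
  have hβ0 := K.hβ0
  have hβ := K.hβ
  have hh := K.hh
  have hh0 : 0 < h := by linarith
  set k : ℕ := ⌊1 / (16 * β)⌋₊ with hk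
  have hk1 : (k : ℝ) ≤ 1 / (16 * β) := Nat.floor_le (by positivity)
  have hk2 : 1 / (16 * β) < k + 1 := Nat.lt_floor_add_one _
  have hB : 1 / (16 * β) = 2 * (1 / (32 * β)) := by field_simp; norm_num
  have hB1 : 1 ≤ 1 / (32 * β) := by
    rw [le_div_iff₀ (by positivity)]; linarith
  have hk3 : 1 / (32 * β) ≤ k := by linarith
  obtain ⟨C, hC, hCc, hCk⟩ := K.caseB_ind hS hdeg k S (Subset.refl _) (by
    rw [le_div_iff₀ (by positivity)] at hk1
    nlinarith)
  have hCh : (C.card : ℝ) < h := by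
    refine lt_of_le_of_lt ?_ K.h0
    exact_mod_cast le_cg (hC.trans hS) hCc
  set t := (h ^ lam) ^ 2 with ht
  have htp : 0 < t := by positivity
  have ht2 : t ^ 2 ≤ 1 / β := by
    have := K.f4
    calc t ^ 2 = (h ^ lam) ^ 4 := by rw [ht]; ring
      _ ≤ _ := this
  have ht3 : 2 * t ≤ k := by
    refine le_trans ?_ hk3
    have h1 : t ^ 2 ≤ (1 / (64 * β)) ^ 2 := by
      refine ht2.trans ?_
      rw [div_pow, div_le_div_iff₀ hβ0 (by positivity)]
      nlinarith
    have h2 := (pow_le_pow_iff_left₀ htp.le (by positivity) (by norm_num)).1 h1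
    have h3 : 1 / (32 * β) = 2 * (1 / (64 * β)) := by field_simp; norm_num
    linarith
  have hw : h / (2 * t) ≤ ((Ω.card : ℝ) / (512 * h ^ 2)) ^ lam := by
    have e : (Ω.card : ℝ) / (512 * h ^ 2) = Ω.card * (1 / 512) / (h * h) := by field_simp
    rw [e, Real.div_rpow (by positivity) (by positivity), Real.mul_rpow hn.le (by norm_num),
      Real.mul_rpow hh0.le hh0.le, K.hdef]
    have h1 := K.f1 (1 / 512) (by
      calc β ^ 10 ≤ β ^ 1 := pow_le_pow_of_le_one hβ0.le (by linarith) (by norm_num)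
        _ ≤ 1 / 512 := by linarith)
    have h2 : t = h ^ lam * h ^ lam := by rw [ht]; ring
    rw [← h2, div_le_div_iff₀ (by positivity) htp]
    have h3 : 0 < h * t := by positivity
    nlinarith
  have h4 : (2 * t) * (h / (2 * t)) ≤ k * ((Ω.card : ℝ) / (512 * h ^ 2)) ^ lam :=
    mul_le_mul ht3 hw (by positivity) (by positivity)
  have h5 : (2 * t) * (h / (2 * t)) = h := by field_simp
  linarith

theorem Crit.false {G : SimpleGraph V} {Ω : Finset V} {lam β h : ℝ} (K : Crit G Ω lam β h) :
    False := by
  have hsplit : (Ω.filter (fun v => ((Ω.filter (fun x => G.Adj v x)).card : ℝ) < β * Ω.card)).card +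
      (Ω.filter (fun v => ¬ ((Ω.filter (fun x => G.Adj v x)).card : ℝ) < β * Ω.card)).card = Ω.card :=
    Finset.card_filter_add_card_filter_not _
  set A := Ω.filter (fun v => ((Ω.filter (fun x => G.Adj v x)).card : ℝ) < β * Ω.card) with hA
  set B := Ω.filter (fun v => ¬ ((Ω.filter (fun x => G.Adj v x)).card : ℝ) < β * Ω.card) with hB
  have hsplit' : (A.card : ℝ) + B.card = Ω.card := by exact_mod_cast hsplit
  rcases le_or_gt ((Ω.card : ℝ) / 2) (A.card : ℝ) with h1 | h1
  · exact K.caseA (filter_subset _ _) h1 (fun v hv => (mem_filter.1 hv).2)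
  · refine K.caseB (filter_subset _ _ : B ⊆ Ω) (by linarith) (fun v hv => ?_)
    have hv' := mem_filter.1 hv
    rcases K.dich hv'.1 with h2 | h2
    · exact h2
    · exact absurd h2 hv'.2

theorem cube_repr (m : ℕ) (hm : 1 ≤ m) : ∃ s : ℝ, 0 ≤ s ∧ (m : ℝ) = (2:ℝ) ^ (s ^ 3) ∧
    (Real.logb 2 m) ^ ((2:ℝ) / 3) = s ^ 2 := by
  have hm' : (1:ℝ) ≤ m := by exact_mod_cast hm
  have hL : 0 ≤ Real.logb 2 m := Real.logb_nonneg (by norm_num) hm'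
  refine ⟨(Real.logb 2 m) ^ ((1:ℝ) / 3), by positivity, ?_, ?_⟩
  · rw [← Real.rpow_natCast, ← Real.rpow_mul hL]
    norm_num
    rw [Real.rpow_logb (by norm_num) (by norm_num) (by linarith)]
  · rw [← Real.rpow_natCast, ← Real.rpow_mul hL]
    norm_num

theorem two_le_cg {G : SimpleGraph V} {S : Finset V} (h : 2 ≤ S.card) : 2 ≤ cg G S := by
  obtain ⟨a, ha, b, hb, hab⟩ := Finset.one_lt_card.1 (show 1 < S.card by omega)
  have h1 := cg_add (G := G) (A := {a}) (B := {b}) (S := S) (by simpa using ha) (by simpa using hb)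
    (by simpa using hab) (by
      by_cases h : G.Adj a b
      · left; simpa using h
      · right; simpa using h)
  have h2 := cg_pos (G := G) (S := {a}) (by simp)
  have h3 := cg_pos (G := G) (S := {b}) (by simp)
  omega

theorem mkCrit {G : SimpleGraph V} (hG : NoP5 G) {Ω : Finset V} {t : ℝ} (ht0 : 0 < t)
    (ht : 1000 < t ^ 2) (hn : (Ω.card : ℝ) = (2:ℝ) ^ (t ^ 3))
    (hcg : (cg G Ω : ℝ) < (2:ℝ) ^ (t ^ 2 / 1000))
    (ih : ∀ Z ⊆ Ω, Z ≠ Ω → Z.Nonempty → ∀ s : ℝ, 0 ≤ s → (Z.card : ℝ) = (2:ℝ) ^ (s ^ 3) →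
      (2:ℝ) ^ (s ^ 2 / 1000) ≤ cg G Z) :
    Crit G Ω (1 / (1000 * t)) ((2:ℝ) ^ (-(100 * t))) ((2:ℝ) ^ (t ^ 2 / 1000)) := by
  have h2 : (0:ℝ) < 2 := by norm_num
  have ht31 : 31 < t := by nlinarith
  have hpow : ∀ (x : ℝ) (k : ℕ), ((2:ℝ) ^ x) ^ k = (2:ℝ) ^ (x * k) := by
    intro x k
    rw [Real.rpow_mul h2.le, Real.rpow_natCast]
  have hmono : ∀ {x y : ℝ}, x ≤ y → (2:ℝ) ^ x ≤ (2:ℝ) ^ y := fun h =>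
    Real.rpow_le_rpow_of_exponent_le (by norm_num) h
  have hinj : ∀ {x y : ℝ}, (2:ℝ) ^ x ≤ (2:ℝ) ^ y → x ≤ y := fun h =>
    (Real.rpow_le_rpow_left_iff (by norm_num)).1 h
  have hcube : ∀ {s r : ℝ}, 0 ≤ s → 0 ≤ r → s ^ 3 ≤ r ^ 3 → s ≤ r := fun hs hr h =>
    (pow_le_pow_iff_left₀ hs hr (by norm_num)).1 h
  refine ⟨hG, by positivity, by positivity, ?_, ?_, ?_, hcg, ?_, ?_, ?_, ?_, ?_, ?_, ?_⟩
  · calc (2:ℝ) ^ (-(100 * t)) ≤ (2:ℝ) ^ (-14 : ℝ) := hmono (by linarith)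
      _ ≤ 1 / 10000 := by
        rw [Real.rpow_neg h2.le]
        rw [show (14:ℝ) = ((14:ℕ):ℝ) by norm_num, Real.rpow_natCast]; norm_num
  · rw [hn, ← Real.rpow_mul h2.le]
    congr 1; field_simp
  · calc (2:ℝ) = (2:ℝ) ^ (1:ℝ) := (Real.rpow_one 2).symm
      _ ≤ _ := hmono (by linarith)
  · intro Z hZ hZn hZ0
    obtain ⟨s, hs0, hs, -⟩ := cube_repr Z.card hZ0.card_pos
    refine le_trans ?_ (ih Z hZ hZn hZ0 s hs0 hs)
    have hle : (Z.card : ℝ) ≤ Ω.card := by exact_mod_cast Finset.card_le_card hZ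
    rw [hs, hn] at hle
    have hst := hcube hs0 ht0.le (hinj hle)
    rw [hs, ← Real.rpow_mul h2.le]
    apply hmono
    rw [mul_one_div, div_le_div_iff₀ (by positivity) (by norm_num)]
    nlinarith [mul_le_mul_of_nonneg_left hst (sq_nonneg s)]
  · intro Z hZ hZn hZ0 hZc
    obtain ⟨s, hs0, hs, -⟩ := cube_repr Z.card hZ0.card_pos
    refine le_trans ?_ (ih Z hZ hZn hZ0 s hs0 hs)
    rw [hs, hpow] at hZc
    have hs3 := hinj hZc
    push_cast at hs3
    have hst : 10 * s ≤ t := by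
      apply hcube (by positivity) ht0.le
      nlinarith [mul_pos ht0 ht0, sq_nonneg t]
    rw [hs, ← Real.rpow_mul h2.le]
    apply hmono
    rw [show s ^ 3 * (10 * (1 / (1000 * t))) = (10 * s ^ 3) / (1000 * t) by ring,
      div_le_div_iff₀ (by positivity) (by norm_num)]
    nlinarith [mul_le_mul_of_nonneg_left hst (sq_nonneg s)]
  · intro x hx
    rw [hpow] at hx
    have := Real.rpow_le_rpow (by positivity) hx (show 0 ≤ 1 / (1000 * t) by positivity)
    rw [← Real.rpow_mul h2.le] at this
    refine le_trans (le_of_eq ?_) this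
    rw [show -(100 * t) * ((10:ℕ):ℝ) * (1 / (1000 * t)) = -1 by push_cast; field_simp; norm_num,
      Real.rpow_neg_one]
    norm_num
  · intro x hx
    rw [hpow] at hx
    have := Real.rpow_lt_rpow (by positivity) hx (show 0 < 2 * (1 / (1000 * t)) by positivity)
    rw [← Real.rpow_mul h2.le] at this
    refine lt_of_eq_of_lt ?_ this
    rw [show -(100 * t) * ((5:ℕ):ℝ) * (2 * (1 / (1000 * t))) = -1 by push_cast; field_simp; norm_num,
      Real.rpow_neg_one]
    norm_num
  · rw [hn, hpow, ← Real.rpow_add h2]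
    calc (1:ℝ) = (2:ℝ) ^ (0:ℝ) := (Real.rpow_zero 2).symm
      _ ≤ _ := hmono (by push_cast; nlinarith)
  · rw [← Real.rpow_mul h2.le, hpow, one_div ((2:ℝ) ^ (-(100 * t))), ← Real.rpow_neg h2.le]
    apply hmono
    push_cast
    rw [show t ^ 2 / 1000 * (1 / (1000 * t)) * 4 = t * (4 / 1000000) by field_simp; norm_num]
    linarith
  · rw [hn]
    calc 8 * (2:ℝ) ^ (t ^ 2 / 1000) = (2:ℝ) ^ (3 + t ^ 2 / 1000) := by
          rw [Real.rpow_add h2, show (3:ℝ) = ((3:ℕ):ℝ) by norm_num, Real.rpow_natCast]; norm_num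
      _ ≤ _ := hmono (by nlinarith)

theorem main_ind {G : SimpleGraph V} (hG : NoP5 G) (k : ℕ) : ∀ S : Finset V, S.card ≤ k →
    S.Nonempty → ∀ s : ℝ, 0 ≤ s → (S.card : ℝ) = (2:ℝ) ^ (s ^ 3) →
    (2:ℝ) ^ (s ^ 2 / 1000) ≤ cg G S := by
  induction k with
  | zero =>
    intro S h1 h2
    have := h2.card_pos
    omega
  | succ k ih =>
    intro S hSk hS0 s hs0 hs
    rcases le_or_gt (s ^ 2) 1000 with hsm | hbig
    · rcases Nat.lt_or_ge S.card 2 with h1 | h1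
      · have hc : S.card = 1 := by have := hS0.card_pos; omega
        have hs' : s = 0 := by
          by_contra hne
          have hp : 0 < s := lt_of_le_of_ne hs0 (Ne.symm hne)
          have : (1:ℝ) < (2:ℝ) ^ (s ^ 3) := Real.one_lt_rpow (by norm_num) (by positivity)
          rw [← hs, hc] at this
          norm_num at this
        subst hs'
        have : (1:ℝ) ≤ cg G S := by exact_mod_cast cg_pos hS0
        simpa using this
      · have : (2:ℝ) ≤ cg G S := by exact_mod_cast two_le_cg h1
        refine le_trans ?_ this
        calc (2:ℝ) ^ (s ^ 2 / 1000) ≤ (2:ℝ) ^ (1:ℝ) :=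
              Real.rpow_le_rpow_of_exponent_le (by norm_num) (by linarith)
          _ = 2 := Real.rpow_one 2
    · by_contra hcon
      push Not at hcon
      have hsp : 0 < s := by
        rcases hs0.eq_or_lt with h | h
        · rw [← h] at hbig; norm_num at hbig
        · exact h
      refine (mkCrit hG hsp hbig hs hcon ?_).false
      intro Z hZ hZn hZ0
      have := Finset.card_lt_card (hZ.ssubset_of_ne hZn)
      exact ih Z (by omega) hZ0

theorem le_homNum {W : Type} [Fintype W] (G : SimpleGraph W) (s : Finset W)
    (hs : IsHomogeneous G s) : s.card ≤ homNum G := by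
  apply le_csSup
  · refine ⟨Fintype.card W, ?_⟩
    rintro k ⟨u, _, rfl⟩
    exact Finset.card_le_univ u
  · exact ⟨s, hs, rfl⟩

end P5EH

theorem stmt_0 :
    ∃ c : ℝ, 0 < c ∧
      ∀ (V : Type) [Fintype V] (G : SimpleGraph V),
        1 ≤ Fintype.card V → P5Free G →
        (2 : ℝ) ^ (c * (Real.logb 2 (Fintype.card V)) ^ ((2 : ℝ) / 3)) ≤ (homNum G : ℝ) := by
  refine ⟨1 / 2000, by norm_num, ?_⟩
  intro V _ G hV hG
  obtain ⟨s, hs0, hs, hs2⟩ := P5EH.cube_repr (Fintype.card V) hV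
  rw [hs2]
  have h1 := P5EH.main_ind (P5EH.noP5_of hG) (Finset.univ : Finset V).card Finset.univ le_rfl
    (by rw [← Finset.card_pos, Finset.card_univ]; omega) s hs0 (by rw [Finset.card_univ]; exact hs)
  obtain ⟨C, -, hC, hCc⟩ := P5EH.exists_cg G (Finset.univ : Finset V)
  obtain ⟨K, I, -, -, hK, hI, hKI⟩ := P5EH.cog_hom hC
  have h2 := P5EH.le_homNum G K (Or.inl hK)
  have h3 := P5EH.le_homNum G I (Or.inr hI)
  have h4 : C.card ≤ homNum G * homNum G := hKI.trans (Nat.mul_le_mul h2 h3)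
  rw [hCc] at h4
  have h5 : (P5EH.cg G (Finset.univ : Finset V) : ℝ) ≤ homNum G * homNum G := by exact_mod_cast h4
  have h6 : (2:ℝ) ^ (s ^ 2 / 1000) =
      (2:ℝ) ^ (1 / 2000 * s ^ 2) * (2:ℝ) ^ (1 / 2000 * s ^ 2) := by
    rw [← Real.rpow_add (by norm_num)]; congr 1; ring
  rw [h6] at h1
  exact (mul_self_le_mul_self_iff (by positivity) (by positivity)).2 (h1.trans h5)
end

section
/- Let G be a P5-free graph on n vertices with m := hom(G) < n. Then there exist disjoint nonempty vertex sets A and B in G with no edges between A and B and with |A|, |B| ≥ n/m^13. -/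
open SimpleGraph

open Classical in
theorem aux_greedy {V : Type} [Fintype V] (G : SimpleGraph V) (t : ℝ) (Y : Finset V)
    (h : ∀ X ⊆ Y, X.Nonempty →
      ∃ v ∈ X, ((X.filter (fun w => w = v ∨ G.Adj v w)).card : ℝ) ≤ t) :
    ∃ I ⊆ Y, Gᶜ.IsClique (I : Set V) ∧ (Y.card : ℝ) ≤ t * I.card := by
  induction Y using Finset.strongInduction with
  | H Y ih =>
    rcases Y.eq_empty_or_nonempty with rfl | hne
    · exact ⟨∅, by simp, by simp, by simp⟩
    · obtain ⟨v, hv, hvt⟩ := h Y (Finset.Subset.refl _) hne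
      set N := Y.filter (fun w => w = v ∨ G.Adj v w) with hN
      have hNY : N ⊆ Y := Finset.filter_subset _ _
      have hvN : v ∈ N := by simp [hN, hv]
      have hlt : Y \ N ⊂ Y := by
        refine Finset.ssubset_iff_subset_ne.2 ⟨Finset.sdiff_subset, fun he => ?_⟩
        have : v ∈ Y \ N := by rw [he]; exact hv
        exact (Finset.mem_sdiff.1 this).2 hvN
      obtain ⟨I, hI, hc, hle⟩ := ih _ hlt (fun X hX hXn => h X (hX.trans Finset.sdiff_subset) hXn)
      have hvI : v ∉ I := fun hvI => (Finset.mem_sdiff.1 (hI hvI)).2 hvN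
      refine ⟨insert v I, ?_, ?_, ?_⟩
      · intro x hx
        rcases Finset.mem_insert.1 hx with rfl | hx
        · exact hv
        · exact (Finset.mem_sdiff.1 (hI hx)).1
      · rw [Finset.coe_insert, SimpleGraph.isClique_insert]
        refine ⟨hc, fun b hb hvb => ?_⟩
        rw [SimpleGraph.compl_adj]
        refine ⟨hvb, fun hadj => ?_⟩
        have hb' := Finset.mem_sdiff.1 (hI hb)
        exact hb'.2 (by simp [hN, hb'.1, hadj])
      · have h1 : (Y \ N).card + N.card = Y.card := Finset.card_sdiff_add_card_eq_card hNY
        have h2 : ((Y \ N).card : ℝ) + N.card = Y.card := by exact_mod_cast h1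
        rw [Finset.card_insert_of_notMem hvI]
        push_cast
        linarith

open Classical in
theorem aux_giant {V : Type} [Fintype V] (G : SimpleGraph V) (q : ℝ)
    (hno : ∀ A B : Finset V, Disjoint A B → (∀ a ∈ A, ∀ b ∈ B, ¬ G.Adj a b) →
      q ≤ A.card → (B.card : ℝ) < q) (hq : 0 < q) (X : Finset V) (hX : 3 * q ≤ X.card) :
    ∃ D ⊆ X, (X.card : ℝ) - q < D.card ∧ (∀ a ∈ D, ∀ b ∈ X \ D, ¬ G.Adj a b) ∧
      (∀ A ⊆ D, A.Nonempty → (D \ A).Nonempty → ∃ a ∈ A, ∃ b ∈ D \ A, G.Adj a b) := by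
  let F := X.powerset.filter (fun D => q ≤ D.card ∧ ∀ a ∈ D, ∀ b ∈ X \ D, ¬ G.Adj a b)
  have hF : F.Nonempty := ⟨X, by
    simp only [F, Finset.mem_filter, Finset.mem_powerset]
    exact ⟨Finset.Subset.refl _, by linarith, by simp⟩⟩
  obtain ⟨D, hD, hmin⟩ := Finset.exists_min_image F Finset.card hF
  simp only [F, Finset.mem_filter, Finset.mem_powerset] at hD hmin
  obtain ⟨hDX, hDq, hDa⟩ := hD
  have hsm := hno D (X \ D) Finset.disjoint_sdiff hDa hDq
  have h1 : ((X \ D).card : ℝ) + D.card = X.card := by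
    exact_mod_cast Finset.card_sdiff_add_card_eq_card hDX
  refine ⟨D, hDX, by linarith, hDa, ?_⟩
  intro A hA hAn hAn'
  by_contra hcon
  push Not at hcon
  have h2 : ((D \ A).card : ℝ) + A.card = D.card := by
    exact_mod_cast Finset.card_sdiff_add_card_eq_card hA
  have p1 : 0 < A.card := hAn.card_pos
  have p2 : 0 < (D \ A).card := hAn'.card_pos
  have h2' : (D \ A).card + A.card = D.card := Finset.card_sdiff_add_card_eq_card hA
  by_cases hc : q ≤ A.card
  · have := hmin A ⟨hA.trans hDX, hc, fun a ha b hb => ?_⟩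
    · omega
    · by_cases hbD : b ∈ D
      · exact hcon a ha b (Finset.mem_sdiff.2 ⟨hbD, (Finset.mem_sdiff.1 hb).2⟩)
      · exact hDa a (hA ha) b (Finset.mem_sdiff.2 ⟨(Finset.mem_sdiff.1 hb).1, hbD⟩)
  · have := hmin (D \ A) ⟨Finset.sdiff_subset.trans hDX, by linarith, fun a ha b hb => ?_⟩
    · omega
    · by_cases hbD : b ∈ D
      · have hbA : b ∈ A := by
          by_contra hbA
          exact (Finset.mem_sdiff.1 hb).2 (Finset.mem_sdiff.2 ⟨hbD, hbA⟩)
        exact fun hadj => hcon b hbA a ha hadj.symm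
      · exact hDa a (Finset.mem_sdiff.1 ha).1 b (Finset.mem_sdiff.2 ⟨(Finset.mem_sdiff.1 hb).1, hbD⟩)

theorem aux_p5 {V : Type} (G : SimpleGraph V) (hP5 : P5Free G) (a b c d e : V)
    (hab : G.Adj a b) (hbc : G.Adj b c) (hcd : G.Adj c d) (hde : G.Adj d e)
    (hac : ¬ G.Adj a c) (had : ¬ G.Adj a d) (hae : ¬ G.Adj a e)
    (hbd : ¬ G.Adj b d) (hbe : ¬ G.Adj b e) (hce : ¬ G.Adj c e) : False := by
  apply hP5
  have key : ∀ i j : Fin 5, G.Adj (![a, b, c, d, e] i) (![a, b, c, d, e] j) ↔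
      (pathGraph 5).Adj i j := by
    intro i j
    rw [pathGraph_adj]
    fin_cases i <;> fin_cases j <;> simp [hab, hbc, hcd, hde, hac, had, hae, hbd, hbe, hce,
      hab.symm, hbc.symm, hcd.symm, hde.symm, G.adj_comm c a, G.adj_comm d a, G.adj_comm e a,
      G.adj_comm d b, G.adj_comm e b, G.adj_comm e c]
  refine ⟨⟨⟨![a, b, c, d, e], ?_⟩, fun {i j} => key i j⟩⟩
  have n1 : a ≠ c := fun h => hae (by subst h; exact absurd hcd had)
  have n2 : a ≠ d := fun h => hac (by subst h; exact hcd.symm)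
  have n3 : a ≠ e := fun h => had (by subst h; exact hde.symm)
  have n4 : b ≠ d := fun h => hbe (by subst h; exact hde)
  have n5 : b ≠ e := fun h => hbd (by subst h; exact hde.symm)
  have n6 : c ≠ e := fun h => hbe (by subst h; exact hbc)
  intro i j hij
  have := hab.ne
  have := hbc.ne
  have := hcd.ne
  have := hde.ne
  fin_cases i <;> fin_cases j <;> simp_all

open Classical in
theorem aux_step {V : Type} [Fintype V] (G : SimpleGraph V) (hP5 : P5Free G) (q : ℝ)
    (hno : ∀ A B : Finset V, Disjoint A B → (∀ a ∈ A, ∀ b ∈ B, ¬ G.Adj a b) →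
      q ≤ A.card → (B.card : ℝ) < q) (hq : 0 < q) (P : Finset V) (hP : 3 * q ≤ P.card) :
    (∃ X ⊆ P, ∃ D ⊆ P, X.Nonempty ∧ D.Nonempty ∧ (∀ x ∈ X, ∀ d ∈ D, G.Adj x d) ∧
      (P.card : ℝ) - 2 * q ≤ X.card + D.card) ∨
    (∃ P1 ⊆ P, (P.card : ℝ) - q < P1.card ∧
      ∀ u s : V, (∀ p ∈ P1, ¬ G.Adj s p) → G.Adj s u → (∃ p ∈ P1, G.Adj u p) →
        ((P1.filter (fun p => ¬ G.Adj u p)).card : ℝ) < 3 * q) := by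
  obtain ⟨P1, hP1, hc1, -, hconn⟩ := aux_giant G q hno hq P hP
  by_cases hall : ∀ u s : V, (∀ p ∈ P1, ¬ G.Adj s p) → G.Adj s u → (∃ p ∈ P1, G.Adj u p) →
        ((P1.filter (fun p => ¬ G.Adj u p)).card : ℝ) < 3 * q
  · exact Or.inr ⟨P1, hP1, hc1, hall⟩
  left
  push Not at hall
  obtain ⟨u, s, hs, hsu, ⟨p0, hp0, hup0⟩, hY⟩ := hall
  set Y := P1.filter (fun p => ¬ G.Adj u p) with hYdef
  obtain ⟨D, hDY, hcD, hDa, hDconn⟩ := aux_giant G q hno hq Y hY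
  have hYP : Y ⊆ P1 := Finset.filter_subset _ _
  have hDP : D ⊆ P1 := hDY.trans hYP
  have hDu : ∀ d ∈ D, ¬ G.Adj u d := fun d hd => (Finset.mem_filter.1 (hDY hd)).2
  have hDq : q ≤ D.card := by linarith
  have hDn : D.Nonempty := by
    rw [← Finset.card_pos]
    have : (0 : ℝ) < D.card := by linarith
    exact_mod_cast this
  have hmix : ∀ x ∈ P1, G.Adj u x → (∃ d ∈ D, G.Adj x d) → ∀ d ∈ D, G.Adj x d := by
    intro x hx hux ⟨d, hd, hxd⟩ d' hd'
    by_contra hxd'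
    obtain ⟨a, ha, b, hb, hab⟩ := hDconn (D.filter (fun d => G.Adj x d)) (Finset.filter_subset _ _)
      ⟨d, by simp [hd, hxd]⟩ ⟨d', by simp [hd', hxd']⟩
    simp only [Finset.mem_filter, Finset.mem_sdiff, not_and] at ha hb
    exact aux_p5 G hP5 s u x a b hsu hux ha.2 hab (hs x hx) (hs a (hDP ha.1)) (hs b (hDP hb.1))
      (hDu a ha.1) (hDu b hb.1) (hb.2 hb.1)
  set X := P1.filter (fun x => ∀ d ∈ D, G.Adj x d) with hXdef
  have hXP : X ⊆ P1 := Finset.filter_subset _ _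
  have hrest : ∀ a ∈ D, ∀ b ∈ P1 \ (X ∪ D), ¬ G.Adj a b := by
    intro a ha b hb hab
    simp only [Finset.mem_sdiff, Finset.mem_union, not_or] at hb
    by_cases hub : G.Adj u b
    · exact hb.2.1 (Finset.mem_filter.2 ⟨hb.1, hmix b hb.1 hub ⟨a, ha, hab.symm⟩⟩)
    · exact hDa a ha b (Finset.mem_sdiff.2 ⟨Finset.mem_filter.2 ⟨hb.1, hub⟩, hb.2.2⟩) hab
  refine ⟨X, hXP.trans hP1, D, hDP.trans hP1, ?_, hDn, fun x hx => (Finset.mem_filter.1 hx).2, ?_⟩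
  · obtain ⟨a, ha, b, hb, hab⟩ := hconn D hDP hDn
      ⟨p0, Finset.mem_sdiff.2 ⟨hp0, fun h => hDu p0 h hup0⟩⟩
    by_contra hX
    rw [Finset.not_nonempty_iff_eq_empty] at hX
    refine hrest a ha b ?_ hab
    rw [hX]; simpa using hb
  · have hsm := hno D (P1 \ (X ∪ D)) (Finset.disjoint_left.2 (fun a ha hb => by
      simp only [Finset.mem_sdiff, Finset.mem_union, not_or] at hb
      exact hb.2.2 ha)) hrest hDq
    have h1 : ((P1 \ (X ∪ D)).card : ℝ) + (X ∪ D).card = P1.card := by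
      exact_mod_cast Finset.card_sdiff_add_card_eq_card (Finset.union_subset hXP hDP)
    have h2 : ((X ∪ D).card : ℝ) ≤ X.card + D.card := by exact_mod_cast Finset.card_union_le X D
    linarith

open Classical in
theorem aux_end {V : Type} [Fintype V] (G : SimpleGraph V) (m : ℕ) (q : ℝ)
    (hno : ∀ A B : Finset V, Disjoint A B → (∀ a ∈ A, ∀ b ∈ B, ¬ G.Adj a b) →
      q ≤ A.card → (B.card : ℝ) < q) (hq : 0 < q)
    (hal : ∀ I : Finset V, Gᶜ.IsClique (I : Set V) → I.card ≤ m)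
    (v : V) (P : Finset V) (hPq : q ≤ P.card)
    (hPv : ∀ p ∈ P, p ≠ v ∧ ¬ G.Adj v p ∧
      (Finset.univ.filter (fun w => w ≠ v ∧ ¬ G.Adj v w)).card ≤
      (Finset.univ.filter (fun w => w ≠ p ∧ ¬ G.Adj p w)).card)
    (hP : ∀ u s : V, (∀ p ∈ P, ¬ G.Adj s p) → G.Adj s u → (∃ p ∈ P, G.Adj u p) →
        ((P.filter (fun p => ¬ G.Adj u p)).card : ℝ) < 3 * q) :
    (P.card : ℝ) / 2 ≤ (6 * Fintype.card V * q / P.card + q + 1) * m := by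
  have hPpos : (0 : ℝ) < P.card := by linarith
  set M : V → Finset V := fun x => Finset.univ.filter (fun w => w ≠ x ∧ ¬ G.Adj x w) with hM
  set S := Finset.univ.filter (fun s => s ∉ P ∧ ∀ p ∈ P, ¬ G.Adj s p) with hS
  set T := Finset.univ.filter (fun u => u ∉ S ∧ ∃ s ∈ S, G.Adj s u) with hT
  have memS : ∀ x, x ∈ S ↔ x ∉ P ∧ ∀ p ∈ P, ¬ G.Adj x p := fun x => by simp [hS]
  have memT : ∀ x, x ∈ T ↔ x ∉ S ∧ ∃ s ∈ S, G.Adj s x := fun x => by simp [hT]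
  have memM : ∀ x w, w ∈ M x ↔ w ≠ x ∧ ¬ G.Adj x w := fun x w => by simp [hM]
  have hvS : v ∈ S := (memS v).2 ⟨fun h => (hPv v h).1 rfl, fun p hp => (hPv p hp).2.1⟩
  have hSq : (S.card : ℝ) < q := by
    refine hno P S (Finset.disjoint_left.2 fun a ha hb => ((memS a).1 hb).1 ha) ?_ hPq
    intro a ha b hb hab
    exact ((memS b).1 hb).2 a ha hab.symm
  have hTq : ∀ u ∈ T, ((P.filter (fun p => ¬ G.Adj u p)).card : ℝ) ≤ 3 * q := by
    intro u hu
    obtain ⟨huS, s, hs, hsu⟩ := (memT u).1 hu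
    refine (hP u s ((memS s).1 hs).2 hsu ?_).le
    by_contra hcon
    push Not at hcon
    exact huS ((memS u).2 ⟨fun huP => ((memS s).1 hs).2 u huP hsu, hcon⟩)
  have hdeg : ∀ p ∈ P, (P.filter (fun w => G.Adj p w)).card ≤ (M p ∩ T).card + S.card := by
    intro p hp
    have e1 : M p ⊆ ((M p ∩ T) ∪ S) ∪ (M p ∩ M v) := by
      intro w hw
      simp only [Finset.mem_union, Finset.mem_inter]
      by_cases hwS : w ∈ S
      · exact Or.inl (Or.inr hwS)
      by_cases hwT : w ∈ T
      · exact Or.inl (Or.inl ⟨hw, hwT⟩)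
      right
      refine ⟨hw, (memM v w).2 ⟨fun h => hwS (h ▸ hvS), fun h => hwT ((memT w).2 ⟨hwS, v, hvS, h⟩)⟩⟩
    have e2 : (M p ∩ M v) ∪ P.filter (fun w => G.Adj p w) ⊆ M v := by
      intro w hw
      simp only [Finset.mem_union, Finset.mem_inter, Finset.mem_filter] at hw
      rcases hw with hw | hw
      · exact hw.2
      · exact (memM v w).2 ⟨(hPv w hw.1).1, (hPv w hw.1).2.1⟩
    have e3 : Disjoint (M p ∩ M v) (P.filter (fun w => G.Adj p w)) := by
      refine Finset.disjoint_left.2 fun a ha hb => ?_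
      exact ((memM p a).1 (Finset.mem_inter.1 ha).1).2 (Finset.mem_filter.1 hb).2
    have c1 := Finset.card_le_card e1
    have c2 := Finset.card_le_card e2
    rw [Finset.card_union_of_disjoint e3] at c2
    have c3 := Finset.card_union_le ((M p ∩ T) ∪ S) (M p ∩ M v)
    have c4 := Finset.card_union_le (M p ∩ T) S
    have c5 : (M v).card ≤ (M p).card := (hPv p hp).2.2
    omega
  have hsum : (∑ p ∈ P, ((M p ∩ T).card : ℝ)) ≤ 3 * q * Fintype.card V := by
    have hsw : ∑ p ∈ P, (M p ∩ T).card = ∑ u ∈ T, (P.filter (fun p => u ∈ M p)).card := by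
      have := Finset.sum_card_bipartiteAbove_eq_sum_card_bipartiteBelow
        (s := P) (t := T) (fun p u => u ∈ M p)
      simp only [Finset.bipartiteAbove, Finset.bipartiteBelow] at this
      rw [← this]
      refine Finset.sum_congr rfl fun p _ => ?_
      congr 1
      ext w
      simp only [Finset.mem_inter, Finset.mem_filter]
      tauto
    have : (∑ p ∈ P, ((M p ∩ T).card : ℝ)) = ∑ u ∈ T, ((P.filter (fun p => u ∈ M p)).card : ℝ) := by
      exact_mod_cast hsw
    rw [this]
    calc ∑ u ∈ T, ((P.filter (fun p => u ∈ M p)).card : ℝ) ≤ ∑ u ∈ T, 3 * q := by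
          refine Finset.sum_le_sum fun u hu => le_trans ?_ (hTq u hu)
          exact_mod_cast Finset.card_le_card (fun p hp => by
            simp only [Finset.mem_filter] at hp ⊢
            exact ⟨hp.1, fun h => ((memM p u).1 hp.2).2 h.symm⟩)
      _ = T.card * (3 * q) := by simp
      _ ≤ Fintype.card V * (3 * q) := by
          have : (T.card : ℝ) ≤ Fintype.card V := by exact_mod_cast Finset.card_le_univ T
          exact mul_le_mul_of_nonneg_right this (by linarith)
      _ = _ := by ring
  have hcardpos : (0 : ℝ) < Fintype.card V := by
    have : 0 < Fintype.card V := Fintype.card_pos_iff.2 ⟨v⟩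
    exact_mod_cast this
  set τ : ℝ := 6 * Fintype.card V * q / P.card with hτ
  have hτpos : 0 < τ := by positivity
  set P2 := P.filter (fun p => ((M p ∩ T).card : ℝ) ≤ τ) with hP2
  set Bd := P.filter (fun p => ¬ ((M p ∩ T).card : ℝ) ≤ τ) with hBd
  have hBdcard : (Bd.card : ℝ) * τ ≤ 3 * q * Fintype.card V := by
    refine le_trans ?_ hsum
    calc (Bd.card : ℝ) * τ = ∑ p ∈ Bd, τ := by simp
      _ ≤ ∑ p ∈ Bd, ((M p ∩ T).card : ℝ) :=
          Finset.sum_le_sum fun p hp => (not_le.1 (Finset.mem_filter.1 hp).2).le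
      _ ≤ _ := Finset.sum_le_sum_of_subset_of_nonneg (Finset.filter_subset _ _)
          (fun _ _ _ => by positivity)
  have hτP : τ * P.card = 6 * Fintype.card V * q := by
    rw [hτ]; field_simp
  have hBd2 : (Bd.card : ℝ) ≤ P.card / 2 := by
    have : (Bd.card : ℝ) * τ ≤ (P.card / 2) * τ := by nlinarith
    exact le_of_mul_le_mul_right this hτpos
  have hsplit : (P2.card : ℝ) + Bd.card = P.card := by
    exact_mod_cast Finset.card_filter_add_card_filter_not (s := P) (fun p => ((M p ∩ T).card : ℝ) ≤ τ)
  obtain ⟨I, -, hI, hIc⟩ := aux_greedy G (τ + q + 1) P2 (by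
    intro X hX ⟨p, hp⟩
    have hp2 := Finset.mem_filter.1 (hX hp)
    refine ⟨p, hp, ?_⟩
    have s1 : X.filter (fun w => w = p ∨ G.Adj p w) ⊆ insert p (P.filter (fun w => G.Adj p w)) := by
      intro w hw
      simp only [Finset.mem_filter, Finset.mem_insert] at hw ⊢
      rcases hw with ⟨h1, h2 | h2⟩
      · exact Or.inl h2
      · exact Or.inr ⟨(Finset.mem_filter.1 (hX h1)).1, h2⟩
    have s2 := (Finset.card_le_card s1).trans (Finset.card_insert_le _ _)
    have s3 := hdeg p hp2.1
    have s4 : (X.filter (fun w => w = p ∨ G.Adj p w)).card ≤ (M p ∩ T).card + S.card + 1 := by omega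
    have s5 : ((X.filter (fun w => w = p ∨ G.Adj p w)).card : ℝ) ≤ (M p ∩ T).card + S.card + 1 := by
      exact_mod_cast s4
    linarith [hp2.2])
  have hIm : (I.card : ℝ) ≤ m := by exact_mod_cast hal I hI
  have : (τ + q + 1) * I.card ≤ (τ + q + 1) * m := mul_le_mul_of_nonneg_left hIm (by linarith)
  linarith

open Classical in
theorem aux_ind {V : Type} [Fintype V] (G : SimpleGraph V) (hP5 : P5Free G) (m : ℕ) (q l : ℝ)
    (hno : ∀ A B : Finset V, Disjoint A B → (∀ a ∈ A, ∀ b ∈ B, ¬ G.Adj a b) →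
      q ≤ A.card → (B.card : ℝ) < q) (hq : 0 < q)
    (hal : ∀ I : Finset V, Gᶜ.IsClique (I : Set V) → I.card ≤ m)
    (v : V) (hl : 5 * q ≤ l) (k : ℕ) : ∀ P : Finset V,
    (∀ p ∈ P, p ≠ v ∧ ¬ G.Adj v p ∧
      (Finset.univ.filter (fun w => w ≠ v ∧ ¬ G.Adj v w)).card ≤
      (Finset.univ.filter (fun w => w ≠ p ∧ ¬ G.Adj p w)).card) →
    1 ≤ k → (∀ I ⊆ P, G.IsClique (I : Set V) → I.card ≤ k) → l * k - 2 * q ≤ P.card →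
    ∃ x : ℝ, l - 3 * q ≤ x ∧
      x / 2 ≤ (6 * Fintype.card V * q / x + q + 1) * m := by
  induction k using Nat.strong_induction_on with
  | _ k ih =>
  intro P hPv hk hcl hcard
  have hk' : (1 : ℝ) ≤ k := by exact_mod_cast hk
  have hlk : l ≤ l * k := by nlinarith
  rcases aux_step G hP5 q hno hq P (by linarith) with
    ⟨X, hX, D, hD, hXn, hDn, hXD, hc⟩ | ⟨P1, hP1, hc1, hall⟩
  · let F : Finset (Finset V) := D.powerset.filter (fun I : Finset V => G.IsClique (I : Set V))
    have hF : F.Nonempty := ⟨∅, by simp [F]⟩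
    obtain ⟨J, hJ, hmax⟩ := Finset.exists_max_image F Finset.card hF
    simp only [F, Finset.mem_filter, Finset.mem_powerset] at hJ hmax
    have hJ1 : 1 ≤ J.card := by
      obtain ⟨d, hd⟩ := hDn
      simpa using hmax {d} ⟨by simpa using hd, by simp⟩
    have hjoin : ∀ I ⊆ X, G.IsClique (I : Set V) → I.card + J.card ≤ k := by
      intro I hI hIc
      have hdis : Disjoint I J := Finset.disjoint_left.2 fun a ha hb =>
        G.loopless.irrefl a (hXD a (hI ha) a (hJ.1 hb))
      rw [← Finset.card_union_of_disjoint hdis]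
      refine hcl _ (Finset.union_subset (hI.trans hX) (hJ.1.trans hD)) ?_
      intro a ha b hb hab
      simp only [Finset.coe_union, Set.mem_union, Finset.mem_coe] at ha hb
      rcases ha with ha | ha <;> rcases hb with hb | hb
      · exact hIc ha hb hab
      · exact hXD a (hI ha) b (hJ.1 hb)
      · exact (hXD b (hI hb) a (hJ.1 ha)).symm
      · exact hJ.2 ha hb hab
    have hJk : 1 + J.card ≤ k := by
      obtain ⟨d, hd⟩ := hXn
      simpa using hjoin {d} (by simpa using hd) (by simp)
    by_cases hDc : l * J.card - 2 * q ≤ D.card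
    · exact ih J.card (by omega) D (fun p hp => hPv p (hD hp)) hJ1
        (fun I hI hIc => hmax I ⟨hI, hIc⟩) hDc
    · refine ih (k - J.card) (by omega) X (fun p hp => hPv p (hX hp)) (by omega)
        (fun I hI hIc => by have := hjoin I hI hIc; omega) ?_
      rw [Nat.cast_sub (by omega)]
      push Not at hDc
      linarith
  · refine ⟨P1.card, by linarith, ?_⟩
    exact aux_end G m q hno hq hal v P1 (by linarith) (fun p hp => hPv p (hP1 hp)) hall

open Classical in
theorem aux_start {V : Type} [Fintype V] (G : SimpleGraph V) (m : ℕ) (hn : 0 < Fintype.card V)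
    (hcl : ∀ I : Finset V, G.IsClique (I : Set V) → I.card ≤ m) :
    ∃ v : V, ∃ P : Finset V, (∀ p ∈ P, p ≠ v ∧ ¬ G.Adj v p ∧
      (Finset.univ.filter (fun w => w ≠ v ∧ ¬ G.Adj v w)).card ≤
      (Finset.univ.filter (fun w => w ≠ p ∧ ¬ G.Adj p w)).card) ∧
      (Fintype.card V : ℝ) / (m + 1) ≤ P.card + 1 := by
  by_contra hcon
  push Not at hcon
  set d : V → ℕ := fun v => (Finset.univ.filter (fun w => w ≠ v ∧ ¬ G.Adj v w)).card with hd
  obtain ⟨I, -, hI, hIc⟩ := aux_greedy Gᶜ ((Fintype.card V : ℝ) / (m + 1)) Finset.univ (by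
    intro X _ hX
    obtain ⟨v, hv, hmin⟩ := Finset.exists_min_image X d hX
    refine ⟨v, hv, ?_⟩
    have h1 := hcon v (X.filter (fun w => Gᶜ.Adj v w)) (fun p hp => by
      simp only [Finset.mem_filter, SimpleGraph.compl_adj] at hp
      exact ⟨hp.2.1.symm, hp.2.2, hmin p hp.1⟩)
    have s1 : X.filter (fun w => w = v ∨ Gᶜ.Adj v w) ⊆ insert v (X.filter (fun w => Gᶜ.Adj v w)) := by
      intro w hw
      simp only [Finset.mem_filter, Finset.mem_insert] at hw ⊢
      tauto
    have s2 := (Finset.card_le_card s1).trans (Finset.card_insert_le _ _)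
    have s3 : ((X.filter (fun w => w = v ∨ Gᶜ.Adj v w)).card : ℝ) ≤
      (X.filter (fun w => Gᶜ.Adj v w)).card + 1 := by exact_mod_cast s2
    refine le_trans (le_of_eq ?_) (s3.trans h1.le)
    congr!)
  rw [compl_compl] at hI
  have hIm : (I.card : ℝ) ≤ m := by exact_mod_cast hcl I hI
  rw [Finset.card_univ] at hIc
  have hn' : (0 : ℝ) < Fintype.card V := by exact_mod_cast hn
  have hm0 : (0 : ℝ) ≤ m := by positivity
  rw [div_mul_eq_mul_div, le_div_iff₀ (by linarith)] at hIc
  nlinarith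

theorem aux_num (n m x q l c : ℝ) (hm : 2 ≤ m) (hq : 1 < q) (hnq : n = q * m ^ 13)
    (hc : n / (m + 1) ≤ c + 1) (hl : l = c / m) :
    5 * q ≤ l ∧ (l - 3 * q ≤ x → ¬ x / 2 ≤ (6 * n * q / x + q + 1) * m) := by
  have hm0 : 0 < m := by linarith
  have h11 : (2 : ℝ) ^ 11 ≤ m ^ 11 := by gcongr
  have h8 : (2 : ℝ) ^ 8 ≤ m ^ 8 := by gcongr
  have hc' : 2 / 3 * (q * m ^ 12) - 1 ≤ c := by
    have : 2 / 3 * (q * m ^ 12) ≤ n / (m + 1) := by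
      rw [le_div_iff₀ (by linarith), hnq]
      have : 0 < q * m ^ 12 := by positivity
      nlinarith
    linarith
  have hl' : 2 / 3 * (q * m ^ 11) - 1 ≤ l := by
    rw [hl, le_div_iff₀ hm0]
    nlinarith
  have hx0 : q * m ^ 11 / 2 ≤ l - 3 * q := by nlinarith
  refine ⟨by nlinarith, fun hx hcon => ?_⟩
  have hx1 : q * m ^ 11 / 2 ≤ x := by linarith
  have hxp : 0 < x := lt_of_lt_of_le (by positivity) hx1
  have e : (6 * n * q / x + q + 1) * m * x = (6 * n * q + (q + 1) * x) * m := by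
    field_simp
    ring
  have h1 : x / 2 * x ≤ (6 * n * q + (q + 1) * x) * m := by
    rw [← e]; exact mul_le_mul_of_nonneg_right hcon hxp.le
  have h3 : (q + 1) * m ≤ x / 8 := by
    have : 2 * q * m ≤ q * m ^ 11 / 16 := by
      have h10 : (2 : ℝ) ^ 10 ≤ m ^ 10 := by gcongr
      have : 0 < q * m := by positivity
      have e : q * m ^ 11 = q * m * m ^ 10 := by ring
      rw [e]; nlinarith
    nlinarith
  have h4 : 6 * n * q * m < 3 / 8 * x * x := by
    have a1 : (q * m ^ 11 / 2) * (q * m ^ 11 / 2) ≤ x * x :=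
      mul_le_mul hx1 hx1 (by positivity) hxp.le
    have a2 : 6 * n * q * m = 6 * (q ^ 2 * m ^ 14) := by rw [hnq]; ring
    have a3 : (q * m ^ 11 / 2) * (q * m ^ 11 / 2) = q ^ 2 * m ^ 14 * m ^ 8 / 4 := by ring
    have : 0 < q ^ 2 * m ^ 14 := by positivity
    rw [a2]
    rw [a3] at a1
    nlinarith
  nlinarith

theorem stmt_1 {V : Type} [Fintype V] (G : SimpleGraph V) (n m : ℕ)
    (hn : n = Fintype.card V) (hm : m = homNum G) (hP5 : P5Free G) (hmn : m < n) :
    ∃ A B : Finset V, A.Nonempty ∧ B.Nonempty ∧ Disjoint A B ∧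
      (∀ a ∈ A, ∀ b ∈ B, ¬ G.Adj a b) ∧
      (n : ℝ) / (m : ℝ) ^ 13 ≤ (A.card : ℝ) ∧ (n : ℝ) / (m : ℝ) ^ 13 ≤ (B.card : ℝ) := by
  classical
  have hhom : ∀ I : Finset V, IsHomogeneous G I → I.card ≤ m := by
    intro I hI
    rw [hm]
    refine le_csSup ⟨Fintype.card V, ?_⟩ ⟨I, hI, rfl⟩
    rintro k ⟨s, -, rfl⟩
    exact Finset.card_le_univ s
  have hcl : ∀ I : Finset V, G.IsClique (I : Set V) → I.card ≤ m := fun I h => hhom I (Or.inl h)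
  have hal : ∀ I : Finset V, Gᶜ.IsClique (I : Set V) → I.card ≤ m := fun I h => hhom I (Or.inr h)
  have hne : ∃ a b : V, a ≠ b ∧ ¬ G.Adj a b := by
    by_contra hcon
    push Not at hcon
    have := hcl Finset.univ (fun a _ b _ hab => hcon a b hab)
    rw [Finset.card_univ] at this
    omega
  obtain ⟨a, b, hab, hnab⟩ := hne
  have hm2 : 2 ≤ m := by
    have := hal {a, b} (by
      rw [Finset.coe_pair, SimpleGraph.isClique_pair]
      intro _
      exact ⟨hab, hnab⟩)
    rwa [Finset.card_pair hab] at this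
  have hm2' : (2 : ℝ) ≤ m := by exact_mod_cast hm2
  set q : ℝ := (n : ℝ) / (m : ℝ) ^ 13 with hqdef
  by_cases hq : q ≤ 1
  · exact ⟨{a}, {b}, by simp, by simp, by simpa using hab, by simpa using hnab,
      by simpa using hq, by simpa using hq⟩
  push Not at hq
  by_contra hcon
  have hno : ∀ A B : Finset V, Disjoint A B → (∀ a ∈ A, ∀ b ∈ B, ¬ G.Adj a b) →
      q ≤ A.card → (B.card : ℝ) < q := by
    intro A B hd hA hAq
    by_contra hB
    push Not at hB
    have pos : ∀ C : Finset V, q ≤ C.card → C.Nonempty := by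
      intro C hC
      rw [← Finset.card_pos]
      have : (0 : ℝ) < C.card := by linarith
      exact_mod_cast this
    exact hcon ⟨A, B, pos A hAq, pos B hB, hd, hA, hAq, hB⟩
  obtain ⟨v, P, hPv, hPc⟩ := aux_start G m (by omega) hcl
  rw [← hn] at hPc
  have hnum := fun x => aux_num n m x q (P.card / m) P.card hm2' hq
    (by rw [hqdef]; field_simp) hPc rfl
  obtain ⟨x, hx1, hx2⟩ := aux_ind G hP5 m q (P.card / m) hno (by linarith) hal v (hnum 0).1 m P hPv
    (by omega) (fun I _ h => hcl I h) (by
      have : (P.card : ℝ) / m * m = P.card := by field_simp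
      linarith)
  rw [← hn] at hx2
  exact (hnum x).2 hx1 hx2
end

section
/- Let G be a P5-free graph on n vertices with m := hom(G) < n. Then there exist disjoint nonempty vertex sets A and B in G with no edges between A and B, with |A|, |B| ≥ n/m^13, and such that both induced subgraphs G[A] and G[B] are connected. -/
open SimpleGraph

namespace P5aux

variable {V : Type}

lemma no_p5 {G : SimpleGraph V} (h : P5Free G) (a b c d e : V)
    (hab : G.Adj a b) (hbc : G.Adj b c) (hcd : G.Adj c d) (hde : G.Adj d e)
    (hac : ¬ G.Adj a c) (had : ¬ G.Adj a d) (hae : ¬ G.Adj a e)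
    (hbd : ¬ G.Adj b d) (hbe : ¬ G.Adj b e) (hce : ¬ G.Adj c e) : False := by
  apply h
  have key : ∀ x y : Fin 5, G.Adj (![a,b,c,d,e] x) (![a,b,c,d,e] y) ↔ (pathGraph 5).Adj x y := by
    intro x y
    rw [pathGraph_adj]
    fin_cases x <;> fin_cases y <;> simp [*, G.adj_comm b a, G.adj_comm c a, G.adj_comm d a,
      G.adj_comm e a, G.adj_comm c b, G.adj_comm d b, G.adj_comm e b, G.adj_comm d c,
      G.adj_comm e c, G.adj_comm e d]
  have n1 : a ≠ b := hab.ne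
  have n2 : a ≠ c := by rintro rfl; exact had hcd
  have n3 : a ≠ d := by rintro rfl; exact hae hde
  have n4 : a ≠ e := by rintro rfl; exact hbe hab.symm
  have n5 : b ≠ c := hbc.ne
  have n6 : b ≠ d := by rintro rfl; exact had hab
  have n7 : b ≠ e := by rintro rfl; exact hae hab
  have n8 : c ≠ d := hcd.ne
  have n9 : c ≠ e := by rintro rfl; exact hbe hbc
  have n10 : d ≠ e := hde.ne
  refine ⟨⟨⟨![a,b,c,d,e], ?_⟩, ?_⟩⟩
  · intro x y hxy
    fin_cases x <;> fin_cases y <;> simp_all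
  · intro x y
    exact key x y

/-- cut form of connectedness -/
def Conn (G : SimpleGraph V) (E : Finset V) : Prop :=
  ∀ T ⊆ E, T.Nonempty → (∀ a ∈ T, ∀ b ∈ E, b ∉ T → ¬ G.Adj a b) → T = E

lemma conn_connected (G : SimpleGraph V) (E : Finset V) (hE : E.Nonempty) (h : Conn G E) :
    (G.induce (E : Set V)).Connected := by
  classical
  obtain ⟨x, hx⟩ := hE
  rw [connected_iff_exists_forall_reachable]
  refine ⟨⟨x, hx⟩, ?_⟩
  set T := E.filter (fun w => ∃ hw : w ∈ E, (G.induce (E : Set V)).Reachable ⟨x, hx⟩ ⟨w, hw⟩) with hT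
  have hTE : T = E := by
    apply h T (Finset.filter_subset _ _) ⟨x, by simp [hT, hx]⟩
    intro a ha b hb hbT hab
    apply hbT
    rw [hT, Finset.mem_filter] at ha ⊢
    obtain ⟨haE, haE', hr⟩ := ha
    refine ⟨hb, hb, hr.trans ?_⟩
    apply Adj.reachable
    exact hab
  rintro ⟨w, hw⟩
  have hw' : w ∈ T := by rw [hTE]; exact hw
  rw [hT, Finset.mem_filter] at hw'
  exact hw'.2.2

/-- `E` is closed in `S` -/
def Closed (G : SimpleGraph V) (E S : Finset V) : Prop :=
  E ⊆ S ∧ ∀ a ∈ E, ∀ b ∈ S, b ∉ E → ¬ G.Adj a b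

lemma exists_comp (G : SimpleGraph V) (S : Finset V) (hS : S.Nonempty) :
    ∃ E, Closed G E S ∧ E.Nonempty ∧ Conn G E := by
  classical
  have hne : (S.powerset.filter (fun E => Closed G E S ∧ E.Nonempty)).Nonempty := by
    refine ⟨S, ?_⟩
    simp only [Finset.mem_filter, Finset.mem_powerset]
    exact ⟨subset_rfl, ⟨subset_rfl, fun a _ b hb hb' => absurd hb hb'⟩, hS⟩
  obtain ⟨E, hE, hmin⟩ := Finset.exists_min_image _ Finset.card hne
  simp only [Finset.mem_filter, Finset.mem_powerset] at hE hmin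
  refine ⟨E, hE.2.1, hE.2.2, ?_⟩
  intro T hTE hT hcl
  have hTS : T ⊆ S := hTE.trans hE.1
  apply Finset.eq_of_subset_of_card_le hTE
  apply hmin
  refine ⟨hTS, ⟨hTS, ?_⟩, hT⟩
  intro a ha b hb hbT
  by_cases hbE : b ∈ E
  · exact hcl a ha b hbE hbT
  · exact hE.2.1.2 a (hTE ha) b hb hbE

lemma indep_of_comps (G : SimpleGraph V) (r : ℕ) : ∀ (k : ℕ) (S : Finset V), S.card ≤ k →
    (∀ E, Closed G E S → Conn G E → E.card ≤ r) →
    ∃ I ⊆ S, Gᶜ.IsClique (I : Set V) ∧ S.card ≤ I.card * r := by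
  classical
  intro k
  induction k with
  | zero =>
    intro S hS _
    refine ⟨∅, by simp, by simp, by simpa using hS⟩
  | succ k ih =>
    intro S hS hr
    rcases S.eq_empty_or_nonempty with rfl | hne
    · exact ⟨∅, by simp, by simp, by simp⟩
    obtain ⟨E, hcl, hEn, hconn⟩ := exists_comp G S hne
    have hEr := hr E hcl hconn
    have hc : (S \ E).card + E.card = S.card := Finset.card_sdiff_add_card_eq_card hcl.1
    have hEpos := hEn.card_pos
    obtain ⟨I, hIS, hI, hIc⟩ := ih (S \ E) (by omega) (by
      intro E' hE' hc'
      apply hr E' ⟨hE'.1.trans Finset.sdiff_subset, ?_⟩ hc'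
      intro a ha b hb hbE'
      by_cases hbE : b ∈ E
      · have := Finset.mem_sdiff.1 (hE'.1 ha)
        intro hab
        exact hcl.2 b hbE a this.1 this.2 hab.symm
      · exact hE'.2 a ha b (Finset.mem_sdiff.2 ⟨hb, hbE⟩) hbE')
    obtain ⟨x, hx⟩ := hEn
    have hxI : x ∉ I := fun h => (Finset.mem_sdiff.1 (hIS h)).2 hx
    refine ⟨insert x I, ?_, ?_, ?_⟩
    · intro y hy
      rcases Finset.mem_insert.1 hy with rfl | hy
      · exact hcl.1 hx
      · exact (Finset.mem_sdiff.1 (hIS hy)).1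
    · rw [Finset.coe_insert, isClique_insert]
      refine ⟨hI, ?_⟩
      intro b hb hxb
      have := Finset.mem_sdiff.1 (hIS hb)
      exact ⟨hxb, hcl.2 x hx b this.1 this.2⟩
    · rw [Finset.card_insert_of_notMem hxI]
      nlinarith

lemma big_comp (G : SimpleGraph V) (m : ℕ)
    (hi : ∀ T : Finset V, Gᶜ.IsClique (T : Set V) → T.card ≤ m) (S : Finset V)
    (hS : S.Nonempty) : ∃ E, Closed G E S ∧ E.Nonempty ∧ Conn G E ∧ S.card ≤ m * E.card := by
  by_contra hcon
  push Not at hcon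
  have hpos := hS.card_pos
  have hm : 0 < m := by
    rcases Nat.eq_zero_or_pos m with rfl | h
    · obtain ⟨x, hx⟩ := hS
      have := hi {x} (by simp)
      simp at this
    · exact h
  obtain ⟨I, -, hI, hIc⟩ := indep_of_comps G ((S.card - 1) / m) S.card S le_rfl (by
    intro E hE hc
    rcases E.eq_empty_or_nonempty with rfl | hne
    · simp
    have := hcon E hE hne hc
    rw [Nat.le_div_iff_mul_le hm]
    have h2 : E.card * m = m * E.card := mul_comm _ _
    omega)
  have h1 := hi I hI
  have h2 : m * ((S.card - 1) / m) ≤ S.card - 1 := Nat.mul_div_le _ _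
  have h3 : I.card * ((S.card - 1) / m) ≤ m * ((S.card - 1) / m) := Nat.mul_le_mul_right _ h1
  omega

open Classical in
lemma greedy (G : SimpleGraph V) (X : Finset V) (d : ℕ) : ∀ (k : ℕ) (L : Finset V), L.card ≤ k →
    L ⊆ X → (∀ v ∈ L, (X.filter (fun w => G.Adj v w)).card + 1 ≤ d) →
    ∃ I ⊆ L, Gᶜ.IsClique (I : Set V) ∧ L.card ≤ I.card * d := by
  intro k
  induction k with
  | zero =>
    intro L hL _ _
    refine ⟨∅, by simp, by simp, by simpa using hL⟩
  | succ k ih =>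
    intro L hL hLX hd
    rcases L.eq_empty_or_nonempty with rfl | hne
    · exact ⟨∅, by simp, by simp, by simp⟩
    obtain ⟨x, hx⟩ := hne
    set K := insert x (X.filter (fun w => G.Adj x w)) with hK
    have hKc : K.card ≤ d := (Finset.card_insert_le _ _).trans (hd x hx)
    have hsub : L \ K ⊆ L := Finset.sdiff_subset
    have hlt : (L \ K).card < L.card := by
      apply Finset.card_lt_card
      rw [Finset.ssubset_iff_of_subset hsub]
      exact ⟨x, hx, by simp [hK]⟩
    have hle : L.card ≤ (L \ K).card + K.card := by
      have := Finset.le_card_sdiff K L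
      omega
    obtain ⟨I, hIS, hI, hIc⟩ := ih (L \ K) (by omega) (hsub.trans hLX)
      (fun v hv => hd v (hsub hv))
    have hxI : x ∉ I := fun h => (Finset.mem_sdiff.1 (hIS h)).2 (by simp [hK])
    refine ⟨insert x I, ?_, ?_, ?_⟩
    · intro y hy
      rcases Finset.mem_insert.1 hy with rfl | hy
      · exact hx
      · exact hsub (hIS hy)
    · rw [Finset.coe_insert, isClique_insert]
      refine ⟨hI, ?_⟩
      intro b hb hxb
      have := Finset.mem_sdiff.1 (hIS hb)
      refine ⟨hxb, fun hadj => this.2 ?_⟩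
      rw [hK, Finset.mem_insert, Finset.mem_filter]
      exact Or.inr ⟨hLX this.1, hadj⟩
    · rw [Finset.card_insert_of_notMem hxI]
      nlinarith

open Classical in
lemma good_vertex (G : SimpleGraph V) (m : ℕ) (hm : 0 < m)
    (hc : ∀ T : Finset V, G.IsClique (T : Set V) → T.card ≤ m)
    (hi : ∀ T : Finset V, Gᶜ.IsClique (T : Set V) → T.card ≤ m) (X : Finset V)
    (hX : X.Nonempty) : ∃ v ∈ X,
      X.card ≤ 2 * m * ((X.filter (fun w => G.Adj v w)).card + 1) ∧
      X.card ≤ 2 * m * ((X.filter (fun w => Gᶜ.Adj v w)).card + 1) := by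
  by_contra hcon
  push Not at hcon
  have hpos := hX.card_pos
  set d := (X.card - 1) / (2 * m) with hd
  have h2 : 2 * m * d ≤ X.card - 1 := Nat.mul_div_le _ _
  have aux : ∀ H : SimpleGraph V, (∀ T : Finset V, Hᶜ.IsClique (T : Set V) → T.card ≤ m) →
      2 * (X.filter (fun v => 2 * m * ((X.filter (fun w => H.Adj v w)).card + 1) < X.card)).card
        < X.card := by
    intro H hH
    set L := X.filter (fun v => 2 * m * ((X.filter (fun w => H.Adj v w)).card + 1) < X.card)
    obtain ⟨I, -, hI, hIc⟩ := greedy H X d L.card L le_rfl (Finset.filter_subset _ _) (by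
      intro v hv
      have := (Finset.mem_filter.1 hv).2
      rw [hd, Nat.le_div_iff_mul_le (by omega), mul_comm]
      omega)
    have h1 := hH I hI
    have h3 : I.card * d ≤ m * d := Nat.mul_le_mul_right _ h1
    have h4 : 2 * m * d = 2 * (m * d) := by ring
    omega
  have a1 := aux G hi
  have a2 : 2 * (X.filter (fun v => 2 * m * ((X.filter (fun w => Gᶜ.Adj v w)).card + 1)
      < X.card)).card < X.card := by
    convert aux Gᶜ (by simpa using hc)
  have hcov : X ⊆ (X.filter (fun v => 2 * m * ((X.filter (fun w => G.Adj v w)).card + 1) < X.card))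
      ∪ (X.filter (fun v => 2 * m * ((X.filter (fun w => Gᶜ.Adj v w)).card + 1) < X.card)) := by
    intro v hv
    rw [Finset.mem_union, Finset.mem_filter, Finset.mem_filter]
    by_cases h : X.card ≤ 2 * m * ((X.filter (fun w => G.Adj v w)).card + 1)
    · exact Or.inr ⟨hv, hcon v hv h⟩
    · exact Or.inl ⟨hv, not_le.1 h⟩
  have := (Finset.card_le_card hcov).trans (Finset.card_union_le _ _)
  omega

open Classical in
/-- every vertex of `B` has at most `t` nonneighbours in `A` -/
def R (G : SimpleGraph V) (t : ℕ) (A B : Finset V) : Prop :=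
  ∀ b ∈ B, (A.filter (fun a => ¬ G.Adj b a)).card ≤ t

lemma R.mono {G : SimpleGraph V} {t : ℕ} {A B A' B' : Finset V} (h : R G t A B)
    (hA : A' ⊆ A) (hB : B' ⊆ B) : R G t A' B' := by
  classical
  intro b hb
  exact (Finset.card_le_card (Finset.filter_subset_filter _ hA)).trans (h b (hB hb))

lemma R_zero {G : SimpleGraph V} {A B : Finset V} :
    R G 0 A B ↔ ∀ b ∈ B, ∀ a ∈ A, G.Adj b a := by
  unfold R
  simp only [Nat.le_zero, Finset.card_eq_zero, Finset.filter_eq_empty_iff, not_not]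

lemma transversal (G : SimpleGraph V) (t q : ℕ) (l : List (Finset V)) :
    l.Pairwise (R G t) → (∀ Z ∈ l, q ≤ Z.card) → t * l.length < q + t →
    ∃ T : Finset V, G.IsClique (T : Set V) ∧ (∀ x ∈ T, ∃ Z ∈ l, x ∈ Z) ∧ T.card = l.length := by
  classical
  induction l with
  | nil => intro _ _ _; exact ⟨∅, by simp, by simp, by simp⟩
  | cons Z l ih =>
    intro hp hq hlen
    rw [List.pairwise_cons] at hp
    rw [List.length_cons] at hlen
    obtain ⟨T, hT, hTl, hTc⟩ := ih hp.2 (fun Z hZ => hq Z (List.mem_cons_of_mem _ hZ)) (by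
      nlinarith)
    have hbad : (T.biUnion (fun b => Z.filter (fun a => ¬ G.Adj b a))).card ≤ T.card * t := by
      apply Finset.card_biUnion_le_card_mul
      intro b hb
      obtain ⟨Y, hY, hbY⟩ := hTl b hb
      exact hp.1 Y hY b hbY
    have hZ := hq Z (by simp)
    have : (T.biUnion (fun b => Z.filter (fun a => ¬ G.Adj b a))).card < Z.card := by
      rw [hTc] at hbad
      nlinarith
    obtain ⟨z, hz, hzb⟩ := Finset.exists_mem_notMem_of_card_lt_card this
    have hadj : ∀ b ∈ T, G.Adj b z := by
      intro b hb
      by_contra hn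
      exact hzb (Finset.mem_biUnion.2 ⟨b, hb, Finset.mem_filter.2 ⟨hz, hn⟩⟩)
    have hzT : z ∉ T := fun h => (hadj z h).ne rfl
    refine ⟨insert z T, ?_, ?_, ?_⟩
    · rw [Finset.coe_insert, isClique_insert]
      exact ⟨hT, fun b hb _ => (hadj b hb).symm⟩
    · intro x hx
      rcases Finset.mem_insert.1 hx with rfl | hx
      · exact ⟨Z, by simp, hz⟩
      · obtain ⟨Y, hY, hxY⟩ := hTl x hx
        exact ⟨Y, List.mem_cons_of_mem _ hY, hxY⟩
    · rw [Finset.card_insert_of_notMem hzT, hTc, List.length_cons]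

/-- valid families -/
def Valid (G : SimpleGraph V) (t q c : ℕ) (X : Finset V) (l : List (Finset V)) : Prop :=
  l.Pairwise (R G t) ∧ (∀ Z ∈ l, q ≤ Z.card ∧ Z ⊆ X) ∧
  ∃ B : Finset V, B.card ≤ c * l.length ∧ ∀ x ∈ X, x ∈ B ∨ ∃ Z ∈ l, x ∈ Z

open Classical in
/-- splittable sets -/
def Splits (G : SimpleGraph V) (t q c : ℕ) (Y : Finset V) : Prop :=
  ∃ E F : Finset V, E ⊆ Y ∧ F ⊆ Y ∧ R G t E F ∧ q ≤ E.card ∧ q ≤ F.card ∧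
    (Y \ (E ∪ F)).card ≤ c

lemma valid_split (G : SimpleGraph V) (t q c : ℕ) (X Y : Finset V) (l : List (Finset V))
    (hl : Valid G t q c X l) (hY : Y ∈ l) (hs : Splits G t q c Y) :
    ∃ l', Valid G t q c X l' ∧ l'.length = l.length + 1 := by
  classical
  obtain ⟨l1, l2, rfl⟩ := List.append_of_mem hY
  obtain ⟨E, F, hE, hF, hR, hEq, hFq, hc⟩ := hs
  obtain ⟨hp, hq, B, hB, hcov⟩ := hl
  refine ⟨l1 ++ E :: F :: l2, ⟨?_, ?_, B ∪ (Y \ (E ∪ F)), ?_, ?_⟩, ?_⟩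
  · rw [List.pairwise_append, List.pairwise_cons] at hp
    rw [List.pairwise_append, List.pairwise_cons, List.pairwise_cons]
    obtain ⟨h1, ⟨h2, h3⟩, h4⟩ := hp
    refine ⟨h1, ⟨?_, ?_, h3⟩, ?_⟩
    · intro a ha
      rcases List.mem_cons.1 ha with rfl | ha
      · exact hR
      · exact (h2 a ha).mono hE subset_rfl
    · intro a ha
      exact (h2 a ha).mono hF subset_rfl
    · intro a ha b hb
      rcases List.mem_cons.1 hb with rfl | hb
      · exact (h4 a ha Y (by simp)).mono subset_rfl hE
      rcases List.mem_cons.1 hb with rfl | hb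
      · exact (h4 a ha Y (by simp)).mono subset_rfl hF
      · exact h4 a ha b (by simp [hb])
  · have hYX := (hq Y hY).2
    intro Z hZ
    simp only [List.mem_append, List.mem_cons] at hZ
    rcases hZ with hZ | rfl | rfl | hZ
    · exact hq Z (by simp [hZ])
    · exact ⟨hEq, hE.trans hYX⟩
    · exact ⟨hFq, hF.trans hYX⟩
    · exact hq Z (by simp [hZ])
  · have := Finset.card_union_le B (Y \ (E ∪ F))
    simp only [List.length_append, List.length_cons] at hB ⊢
    nlinarith
  · intro x hx
    rcases hcov x hx with h | ⟨Z, hZ, hxZ⟩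
    · left; simp [h]
    · simp only [List.mem_append, List.mem_cons] at hZ
      rcases hZ with hZ | rfl | hZ
      · right; exact ⟨Z, by simp [hZ], hxZ⟩
      · by_cases h1 : x ∈ E
        · right; exact ⟨E, by simp, h1⟩
        by_cases h2 : x ∈ F
        · right; exact ⟨F, by simp, h2⟩
        left; simp [h1, h2, hxZ]
      · right; exact ⟨Z, by simp [hZ], hxZ⟩
  · simp only [List.length_append, List.length_cons]; omega

lemma valid_length (G : SimpleGraph V) (m t q c : ℕ)
    (hc : ∀ T : Finset V, G.IsClique (T : Set V) → T.card ≤ m) (htq : t * m < q)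
    (X : Finset V) (l : List (Finset V)) (hl : Valid G t q c X l) : l.length ≤ m := by
  by_contra hcon
  push Not at hcon
  have hsub : (l.take (m+1)).Sublist l := List.take_sublist _ _
  have hlen : (l.take (m+1)).length = m + 1 := by rw [List.length_take]; omega
  obtain ⟨T, hT, -, hTc⟩ := transversal G t q (l.take (m+1)) (hl.1.sublist hsub)
    (fun Z hZ => (hl.2.1 Z (hsub.subset hZ)).1) (by rw [hlen]; nlinarith)
  have := hc T hT
  omega

lemma exists_unsplit (G : SimpleGraph V) (m t q c : ℕ)
    (hc : ∀ T : Finset V, G.IsClique (T : Set V) → T.card ≤ m) (htq : t * m < q)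
    (X : Finset V) (hX : q ≤ X.card) : ∃ l Y, Valid G t q c X l ∧ Y ∈ l ∧ l.length ≤ m ∧
      X.card ≤ m * Y.card + m * c ∧ ¬ Splits G t q c Y := by
  classical
  by_contra hcon
  push Not at hcon
  have big : ∀ l, Valid G t q c X l → ∃ Y ∈ l, X.card ≤ m * Y.card + m * c := by
    intro l hl
    have hlen := valid_length G m t q c hc htq X l hl
    obtain ⟨B, hB, hcov⟩ := hl.2.2
    by_contra hno
    push Not at hno
    have hXpos : 0 < X.card := by omega
    have hsub : X ⊆ B ∪ l.toFinset.biUnion id := by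
      intro x hx
      rcases hcov x hx with h | ⟨Z, hZ, hxZ⟩
      · simp [h]
      · rw [Finset.mem_union, Finset.mem_biUnion]
        exact Or.inr ⟨Z, by simpa using hZ, hxZ⟩
    have h1 := (Finset.card_le_card hsub).trans (Finset.card_union_le _ _)
    set M := l.toFinset.sup Finset.card with hM
    have h2 : (l.toFinset.biUnion id).card ≤ l.toFinset.card * M := by
      apply Finset.card_biUnion_le_card_mul
      intro Z hZ
      exact Finset.le_sup (f := Finset.card) hZ
    have h3 : l.toFinset.card ≤ l.length := List.toFinset_card_le l
    have h4 : m * M + m * c < X.card ∨ l = [] := by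
      rcases l.eq_nil_or_concat with h | h
      · exact Or.inr h
      left
      have hne : l.toFinset.Nonempty := by
        obtain ⟨a, b, rfl⟩ := h
        exact ⟨b, by simp⟩
      obtain ⟨Y, hY, hYM⟩ := Finset.exists_mem_eq_sup _ hne Finset.card
      rw [hM, hYM]
      exact hno Y (by simpa using hY)
    rcases h4 with h4 | rfl
    · have h5 : l.toFinset.card * M ≤ m * M := Nat.mul_le_mul_right _ (h3.trans hlen)
      have h6 : c * l.length ≤ c * m := Nat.mul_le_mul_left _ hlen
      have h7 : c * m = m * c := mul_comm _ _
      omega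
    · simp at h1 hB
      subst hB
      simp at h1
      subst h1
      simp at hXpos
  have all : ∀ k : ℕ, ∃ l, Valid G t q c X l ∧ l.length = k + 1 := by
    intro k
    induction k with
    | zero =>
      refine ⟨[X], ⟨by simp, by simpa using hX, ∅, by simp, by simp⟩, by simp⟩
    | succ k ih =>
      obtain ⟨l, hl, hlk⟩ := ih
      obtain ⟨Y, hY, hYc⟩ := big l hl
      obtain ⟨l', hl', hlk'⟩ := valid_split G t q c X Y l hl hY
        (hcon l Y hl hY (valid_length G m t q c hc htq X l hl) hYc)
      exact ⟨l', hl', by omega⟩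
  obtain ⟨l, hl, hlk⟩ := all m
  have := valid_length G m t q c hc htq X l hl
  omega

/-- no large anticomplete pair -/
def NoPair (G : SimpleGraph V) (s : ℕ) : Prop :=
  ∀ A B : Finset V, Disjoint A B → (∀ a ∈ A, ∀ b ∈ B, ¬ G.Adj a b) → s ≤ A.card → B.card < s

open Classical in
lemma giant (G : SimpleGraph V) (m s : ℕ) (hs : 1 ≤ s) (hm : 0 < m)
    (hi : ∀ T : Finset V, Gᶜ.IsClique (T : Set V) → T.card ≤ m) (hno : NoPair G s)
    (S : Finset V) (hS : m * s ≤ S.card) :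
    ∃ E, Closed G E S ∧ E.Nonempty ∧ Conn G E ∧ s ≤ E.card ∧ (S \ E).card < s := by
  have hpos : 0 < m * s := Nat.mul_pos hm hs
  obtain ⟨E, h1, h2, h3, h4⟩ := big_comp G m hi S (Finset.card_pos.1 (by omega))
  have h5 : s ≤ E.card := Nat.le_of_mul_le_mul_left (hS.trans h4) hm
  refine ⟨E, h1, h2, h3, h5, hno E (S \ E) Finset.disjoint_sdiff ?_ h5⟩
  intro a ha b hb
  rw [Finset.mem_sdiff] at hb
  exact h1.2 a ha b hb.1 hb.2

open Classical in
/-- dichotomy for a neighbour `b` of `v` -/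
lemma dichotomy (G : SimpleGraph V) (hP : P5Free G) (m s : ℕ) (hs : 1 ≤ s) (hm : 0 < m)
    (hi : ∀ T : Finset V, Gᶜ.IsClique (T : Set V) → T.card ≤ m) (hno : NoPair G s)
    (Y E : Finset V) (hY : ¬ Splits G 0 1 (3 * s) Y) (hE : Closed G E Y) (hconn : Conn G E)
    (hYE : (Y \ E).card < s) (v b : V) (hvb : G.Adj v b) (hvE : ∀ e ∈ E, ¬ G.Adj v e)
    (hb : m * s < (E.filter (fun e => ¬ G.Adj b e)).card) : ∀ e ∈ E, ¬ G.Adj b e := by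
  set S := E.filter (fun e => ¬ G.Adj b e) with hSdef
  have hSE : S ⊆ E := Finset.filter_subset _ _
  obtain ⟨E', hcl, hne, hcon', hE's, hrest⟩ := giant G m s hs hm hi hno S hb.le
  have hE'S : ∀ e ∈ E', e ∈ E ∧ ¬ G.Adj b e := fun e he => Finset.mem_filter.1 (hcl.1 he)
  set D := E.filter (fun d => G.Adj b d ∧ ∃ e ∈ E', G.Adj d e) with hD
  rcases D.eq_empty_or_nonempty with hDe | hDn
  · have : E' = E := by
      apply hconn E' (fun e he => (hE'S e he).1) hne
      intro a ha c hc hcE' hac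
      by_cases hbc : G.Adj b c
      · have : c ∈ D := Finset.mem_filter.2 ⟨hc, hbc, a, ha, hac.symm⟩
        rw [hDe] at this
        simp at this
      · exact hcl.2 a ha c (Finset.mem_filter.2 ⟨hc, hbc⟩) hcE' hac
    intro e he
    rw [← this] at he
    exact (hE'S e he).2
  · exfalso
    apply hY
    refine ⟨E', D, fun e he => hE.1 (hE'S e he).1, (Finset.filter_subset _ _).trans hE.1, ?_,
      hne.card_pos, hDn.card_pos, ?_⟩
    · rw [R_zero]
      intro d hd e he
      obtain ⟨hdE, hbd, e0, he0, hde0⟩ := Finset.mem_filter.1 hd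
      have hT : E'.filter (fun x => G.Adj d x) = E' := by
        apply hcon' _ (Finset.filter_subset _ _) ⟨e0, Finset.mem_filter.2 ⟨he0, hde0⟩⟩
        intro x hx y hy hyT hxy
        obtain ⟨hxE', hdx⟩ := Finset.mem_filter.1 hx
        have hdy : ¬ G.Adj d y := fun h => hyT (Finset.mem_filter.2 ⟨hy, h⟩)
        exact no_p5 hP v b d x y hvb hbd hdx hxy (hvE d hdE) (hvE x (hE'S x hxE').1)
          (hvE y (hE'S y hy).1) (hE'S x hxE').2 (hE'S y hy).2 hdy
      rw [← hT] at he
      exact (Finset.mem_filter.1 he).2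
    · set J := E.filter (fun d => G.Adj b d ∧ ¬ ∃ e ∈ E', G.Adj d e) with hJ
      have hJc : J.card < s := by
        apply hno E' J ?_ ?_ hE's
        · rw [Finset.disjoint_left]
          intro x hx hxJ
          exact (hE'S x hx).2 (Finset.mem_filter.1 hxJ).2.1
        · intro x hx y hy hxy
          exact (Finset.mem_filter.1 hy).2.2 ⟨x, hx, hxy.symm⟩
      have hsub : Y \ (E' ∪ D) ⊆ (Y \ E) ∪ ((S \ E') ∪ J) := by
        intro x hx
        simp only [Finset.mem_sdiff, Finset.mem_union, hD, hJ, hSdef, Finset.mem_filter] at hx ⊢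
        by_cases h1 : x ∈ E
        · by_cases h2 : G.Adj b x
          · by_cases h3 : ∃ e ∈ E', G.Adj x e
            · exact absurd (Or.inr ⟨h1, h2, h3⟩) hx.2
            · exact Or.inr (Or.inr ⟨h1, h2, h3⟩)
          · exact Or.inr (Or.inl ⟨⟨h1, h2⟩, fun h => hx.2 (Or.inl h)⟩)
        · exact Or.inl ⟨hx.1, h1⟩
      have h1 := Finset.card_le_card hsub
      have h2 := Finset.card_union_le (Y \ E) ((S \ E') ∪ J)
      have h3 := Finset.card_union_le (S \ E') J
      omega

lemma splits_big (G : SimpleGraph V) (hP : P5Free G) (m s : ℕ) (hs : 1 ≤ s) (hm : 2 ≤ m)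
    (hc : ∀ T : Finset V, G.IsClique (T : Set V) → T.card ≤ m)
    (hi : ∀ T : Finset V, Gᶜ.IsClique (T : Set V) → T.card ≤ m) (hno : NoPair G s)
    (X : Finset V) (hX : m ^ 9 * s ≤ X.card) : Splits G (m * s) (m ^ 3 * s) (6 * m * s) X := by
  classical
  have hm0 : 0 < m := by omega
  have hXpos : 0 < X.card := lt_of_lt_of_le (by positivity) hX
  obtain ⟨v, hvX, hN, hM⟩ := good_vertex G m hm0 hc hi X (Finset.card_pos.1 hXpos)
  set N := X.filter (fun w => G.Adj v w) with hNdef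
  set M := X.filter (fun w => Gᶜ.Adj v w) with hMdef
  have pw : ∀ k, 2 * (m ^ k * s) ≤ m ^ (k+1) * s := by
    intro k
    have : m ^ (k+1) * s = m * (m ^ k * s) := by ring
    rw [this]
    exact Nat.mul_le_mul_right _ hm
  have arith : ∀ a, X.card ≤ 2 * m * (a + 1) → m ^ 6 * s ≤ a := by
    intro a ha
    have h1 : m ^ 9 * s = m * (m ^ 8 * s) := by ring
    have h2 : m * (m ^ 8 * s) ≤ m * (2 * (a + 1)) := by
      have : m * (2 * (a + 1)) = 2 * m * (a + 1) := by ring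
      rw [this, ← h1]; omega
    have h3 := Nat.le_of_mul_le_mul_left h2 hm0
    have h4 : 2 * (m ^ 7 * s) ≤ m ^ 8 * s := pw 7
    have h5 : 2 * (m ^ 6 * s) ≤ m ^ 7 * s := pw 6
    have h6 : 0 < m ^ 6 * s := by positivity
    omega
  have hN6 := arith _ hN
  have hM6 := arith _ hM
  have p0 : 2 * (m ^ 0 * s) ≤ m ^ 1 * s := pw 0
  have p1 : 2 * (m ^ 1 * s) ≤ m ^ 2 * s := pw 1
  have p2 : 2 * (m ^ 2 * s) ≤ m ^ 3 * s := pw 2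
  have p3 : 2 * (m ^ 3 * s) ≤ m ^ 4 * s := pw 3
  have p4 : 2 * (m ^ 4 * s) ≤ m ^ 5 * s := pw 4
  have p5 : 2 * (m ^ 5 * s) ≤ m ^ 6 * s := pw 5
  norm_num at p0 p1
  obtain ⟨l, Y, hl, hYl, hlen, hYc, hYs⟩ := exists_unsplit G m 0 1 (3 * s) hc (by omega) M (by omega)
  have hYc' : m ^ 5 * s ≤ Y.card + 3 * s := by
    apply Nat.le_of_mul_le_mul_left _ hm0
    calc m * (m ^ 5 * s) = m ^ 6 * s := by ring
      _ ≤ M.card := hM6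
      _ ≤ _ := hYc
      _ = _ := by ring
  obtain ⟨E, hEcl, hEn, hEconn, hEs, hYE⟩ := giant G m s hs hm0 hi hno Y (by omega)
  have hYM : Y ⊆ M := (hl.2.1 Y hYl).2
  have hEM : E ⊆ M := hEcl.1.trans hYM
  have hvE : ∀ e ∈ E, ¬ G.Adj v e := fun e he => ((Finset.mem_filter.1 (hEM he)).2).2
  have hEc : Y.card ≤ (Y \ E).card + E.card := by
    have := Finset.le_card_sdiff E Y
    omega
  set W := N.filter (fun b => ∀ e ∈ E, ¬ G.Adj b e) with hW
  have hWc : W.card < s := by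
    apply hno E W ?_ ?_ hEs
    · rw [Finset.disjoint_left]
      intro x hx hxW
      exact hvE x hx (Finset.mem_filter.1 (Finset.mem_filter.1 hxW).1).2
    · intro a ha b hb hab
      exact (Finset.mem_filter.1 hb).2 a ha hab.symm
  set U := M.filter (fun u => ∀ e ∈ E, G.Adj u e) with hU
  obtain ⟨B, hBc, hcov⟩ := hl.2.2
  have hWN : W ⊆ N := Finset.filter_subset _ _
  have hNW : (N \ W).card + W.card = N.card := Finset.card_sdiff_add_card_eq_card hWN
  refine ⟨E, (N \ W) ∪ U, hEM.trans (Finset.filter_subset _ _), ?_, ?_, ?_, ?_, ?_⟩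
  · apply Finset.union_subset
    · exact Finset.sdiff_subset.trans (Finset.filter_subset _ _)
    · exact (Finset.filter_subset _ _).trans (Finset.filter_subset _ _)
  · intro b hb
    rcases Finset.mem_union.1 hb with hb | hb
    · obtain ⟨hbN, hbW⟩ := Finset.mem_sdiff.1 hb
      by_contra hcon
      push Not at hcon
      apply hbW
      refine Finset.mem_filter.2 ⟨hbN, ?_⟩
      exact dichotomy G hP m s hs hm0 hi hno Y E hYs hEcl hEconn hYE v b
        (Finset.mem_filter.1 hbN).2 hvE hcon
    · have h0 : E.filter (fun a => ¬ G.Adj b a) = ∅ := by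
        rw [Finset.filter_eq_empty_iff]
        intro e he
        rw [not_not]
        exact (Finset.mem_filter.1 hb).2 e he
      rw [h0]; simp
  · omega
  · have := Finset.card_le_card (Finset.subset_union_left : N \ W ⊆ (N \ W) ∪ U)
    omega
  · have hsub : X \ (E ∪ ((N \ W) ∪ U)) ⊆ ({v} ∪ W) ∪ (B ∪ (Y \ E)) := by
      intro x hx
      rw [Finset.mem_sdiff] at hx
      obtain ⟨hxX, hxn⟩ := hx
      simp only [Finset.mem_union, not_or, Finset.mem_sdiff] at hxn
      obtain ⟨hxE, hxNW, hxU⟩ := hxn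
      simp only [Finset.mem_union, Finset.mem_singleton, Finset.mem_sdiff]
      by_cases hxv : x = v
      · simp [hxv]
      by_cases hadj : G.Adj v x
      · have hxN : x ∈ N := Finset.mem_filter.2 ⟨hxX, hadj⟩
        left; right
        by_contra hh
        exact hxNW ⟨hxN, hh⟩
      · have hxM : x ∈ M := Finset.mem_filter.2 ⟨hxX, fun h => hxv h.symm, hadj⟩
        right
        rcases hcov x hxM with h | ⟨Z, hZ, hxZ⟩
        · exact Or.inl h
        · right
          refine ⟨?_, hxE⟩
          by_contra hxY
          apply hxU
          refine Finset.mem_filter.2 ⟨hxM, ?_⟩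
          intro e he
          have heY := hEcl.1 he
          obtain ⟨l1, l2, rfl⟩ := List.append_of_mem hYl
          have hp := hl.1
          rw [List.pairwise_append, List.pairwise_cons] at hp
          simp only [List.mem_append, List.mem_cons] at hZ
          rcases hZ with hZ | rfl | hZ
          · exact (R_zero.1 (hp.2.2 Z hZ Y (by simp)) e heY x hxZ).symm
          · exact absurd hxZ hxY
          · exact R_zero.1 (hp.2.1.1 Z hZ) x hxZ e heY
    have h1 := Finset.card_le_card hsub
    have h2 := Finset.card_union_le ({v} ∪ W) (B ∪ (Y \ E))
    have h3 := Finset.card_union_le {v} W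
    have h4 := Finset.card_union_le B (Y \ E)
    rw [Finset.card_singleton] at h3
    have h5 : 3 * s * l.length ≤ 3 * s * m := Nat.mul_le_mul_left _ hlen
    have h6 : 3 * s * m = 3 * (m * s) := by ring
    have h7 : 6 * m * s = 6 * (m * s) := by ring
    omega

lemma core [Fintype V] (G : SimpleGraph V) (hP : P5Free G) (m s : ℕ) (hs : 1 ≤ s) (hm : 2 ≤ m)
    (hc : ∀ T : Finset V, G.IsClique (T : Set V) → T.card ≤ m)
    (hi : ∀ T : Finset V, Gᶜ.IsClique (T : Set V) → T.card ≤ m)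
    (hn : m ^ 11 * s ≤ Fintype.card V) : ¬ NoPair G s := by
  intro hno
  have hm0 : 0 < m := by omega
  have pw : ∀ k, 2 * (m ^ k * s) ≤ m ^ (k+1) * s := by
    intro k
    have : m ^ (k+1) * s = m * (m ^ k * s) := by ring
    rw [this]
    exact Nat.mul_le_mul_right _ hm
  have p1 : 2 * (m ^ 1 * s) ≤ m ^ 2 * s := pw 1
  have p2 : 2 * (m ^ 2 * s) ≤ m ^ 3 * s := pw 2
  have p3 : 2 * (m ^ 3 * s) ≤ m ^ 4 * s := pw 3
  have p4 : 2 * (m ^ 4 * s) ≤ m ^ 5 * s := pw 4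
  have p5 : 2 * (m ^ 5 * s) ≤ m ^ 6 * s := pw 5
  have p6 : 2 * (m ^ 6 * s) ≤ m ^ 7 * s := pw 6
  have p7 : 2 * (m ^ 7 * s) ≤ m ^ 8 * s := pw 7
  have p8 : 2 * (m ^ 8 * s) ≤ m ^ 9 * s := pw 8
  have p9 : 2 * (m ^ 9 * s) ≤ m ^ 10 * s := pw 9
  have p10 : 2 * (m ^ 10 * s) ≤ m ^ 11 * s := pw 10
  norm_num at p1
  have hpos : 0 < m * s := by positivity
  have e2 : m * s * m = m ^ 2 * s := by ring
  obtain ⟨l, Y, hl, hYl, hlen, hYc, hYs⟩ := exists_unsplit G m (m * s) (m ^ 3 * s) (6 * m * s) hc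
    (by omega) Finset.univ (by rw [Finset.card_univ]; omega)
  apply hYs
  apply splits_big G hP m s hs hm hc hi hno
  rw [Finset.card_univ] at hYc
  have : m ^ 10 * s ≤ Y.card + 6 * m * s := by
    apply Nat.le_of_mul_le_mul_left _ hm0
    calc m * (m ^ 10 * s) = m ^ 11 * s := by ring
      _ ≤ _ := hn
      _ ≤ _ := hYc
      _ = _ := by ring
  have e6 : 6 * m * s = 6 * (m * s) := by ring
  omega

end P5aux

theorem stmt_2 {V : Type} [Fintype V] (G : SimpleGraph V) (n m : ℕ)
    (hn : n = Fintype.card V) (hm : m = homNum G) (hP5 : P5Free G) (hmn : m < n) :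
    ∃ A B : Finset V, A.Nonempty ∧ B.Nonempty ∧ Disjoint A B ∧
      (∀ a ∈ A, ∀ b ∈ B, ¬ G.Adj a b) ∧
      (n : ℝ) / (m : ℝ) ^ 13 ≤ (A.card : ℝ) ∧ (n : ℝ) / (m : ℝ) ^ 13 ≤ (B.card : ℝ) ∧
      (G.induce (A : Set V)).Connected ∧ (G.induce (B : Set V)).Connected := by
  classical
  have hbdd : BddAbove {k : ℕ | ∃ s : Finset V, IsHomogeneous G s ∧ s.card = k} := by
    refine ⟨Fintype.card V, ?_⟩
    rintro k ⟨s, -, rfl⟩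
    exact Finset.card_le_univ s
  have hom : ∀ T : Finset V, IsHomogeneous G T → T.card ≤ m := by
    intro T hT
    rw [hm]
    exact le_csSup hbdd ⟨T, hT, rfl⟩
  have hc : ∀ T : Finset V, G.IsClique (T : Set V) → T.card ≤ m := fun T h => hom T (Or.inl h)
  have hi : ∀ T : Finset V, Gᶜ.IsClique (T : Set V) → T.card ≤ m := fun T h => hom T (Or.inr h)
  obtain ⟨x, y, hxy, hnadj⟩ : ∃ x y : V, x ≠ y ∧ ¬ G.Adj x y := by
    by_contra hcon
    push Not at hcon
    have := hc Finset.univ (fun x _ y _ hxy => hcon x y hxy)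
    rw [Finset.card_univ] at this
    omega
  have hm2 : 2 ≤ m := by
    have := hi {x, y} (by
      rw [Finset.coe_insert, Finset.coe_singleton, isClique_insert]
      refine ⟨by simp, ?_⟩
      rintro b rfl hb
      exact ⟨hxy, hnadj⟩)
    rwa [Finset.card_pair hxy] at this
  have hm0 : 0 < m := by omega
  have hmR : (0 : ℝ) < (m : ℝ) := by exact_mod_cast hm0
  suffices h : ∃ A B : Finset V, A.Nonempty ∧ B.Nonempty ∧ Disjoint A B ∧
      (∀ a ∈ A, ∀ b ∈ B, ¬ G.Adj a b) ∧ n ≤ A.card * m ^ 13 ∧ n ≤ B.card * m ^ 13 ∧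
      P5aux.Conn G A ∧ P5aux.Conn G B by
    obtain ⟨A, B, hA, hB, hd, hac, h1, h2, h3, h4⟩ := h
    refine ⟨A, B, hA, hB, hd, hac, ?_, ?_, P5aux.conn_connected G A hA h3,
      P5aux.conn_connected G B hB h4⟩
    · rw [div_le_iff₀ (by positivity)]
      exact_mod_cast h1
    · rw [div_le_iff₀ (by positivity)]
      exact_mod_cast h2
  by_cases hsmall : n ≤ m ^ 13
  · refine ⟨{x}, {y}, by simp, by simp, by simpa using hxy, by simpa using hnadj, by simpa using hsmall,
      by simpa using hsmall, ?_, ?_⟩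
    · intro T hT hne _
      exact (Finset.subset_singleton_iff.1 hT).resolve_left hne.ne_empty
    · intro T hT hne _
      exact (Finset.subset_singleton_iff.1 hT).resolve_left hne.ne_empty
  push Not at hsmall
  set s := n / m ^ 12 + 1 with hs
  have hs1 : n ≤ s * m ^ 12 := by
    have := Nat.lt_div_mul_add (a := n) (b := m ^ 12) (by positivity)
    rw [hs, add_mul, one_mul]
    exact this.le
  have hs2 : m ^ 11 * s ≤ n := by
    have h1 : n / m ^ 12 * m ^ 12 ≤ n := Nat.div_mul_le_self _ _
    have h2 : 2 * (n / m ^ 12 * m ^ 11) ≤ n / m ^ 12 * m ^ 12 := by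
      have : n / m ^ 12 * m ^ 12 = m * (n / m ^ 12 * m ^ 11) := by ring
      rw [this]
      exact Nat.mul_le_mul_right _ hm2
    have h3 : 2 * m ^ 11 ≤ m ^ 13 := by
      have : m ^ 13 = (m * m) * m ^ 11 := by ring
      rw [this]
      exact Nat.mul_le_mul_right _ (by nlinarith)
    have h4 : m ^ 11 * s = n / m ^ 12 * m ^ 11 + m ^ 11 := by rw [hs]; ring
    omega
  have hspos : 1 ≤ s := by rw [hs]; exact Nat.le_add_left _ _
  clear hs
  clear_value s
  have hcore := P5aux.core G hP5 m s (by omega) hm2 hc hi (by rw [← hn]; exact hs2)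
  unfold P5aux.NoPair at hcore
  push Not at hcore
  obtain ⟨A, B, hd, hac, hA, hB⟩ := hcore
  obtain ⟨A', hA1, hA2, hA3, hA4⟩ := P5aux.big_comp G m hi A (Finset.card_pos.1 (by omega))
  obtain ⟨B', hB1, hB2, hB3, hB4⟩ := P5aux.big_comp G m hi B (Finset.card_pos.1 (by omega))
  have fin : ∀ C C' : Finset V, s ≤ C.card → C.card ≤ m * C'.card → n ≤ C'.card * m ^ 13 := by
    intro C C' h1 h2
    calc n ≤ s * m ^ 12 := hs1
      _ ≤ (m * C'.card) * m ^ 12 := Nat.mul_le_mul_right _ (h1.trans h2)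
      _ = _ := by ring
  exact ⟨A', B', hA2, hB2, Finset.disjoint_of_subset_left hA1.1
    (Finset.disjoint_of_subset_right hB1.1 hd),
    fun a ha b hb => hac a (hA1.1 ha) b (hB1.1 hb), fin A A' hA hA4, fin B B' hB hB4, hA3, hB3⟩
end
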